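/- arXiv:2409.08835 — 3 statements merged into one kernel-verified Lean document; each statement's English description precedes it below -/
import Mathlib

section
/- Let χ : ℝ³ → [0,1] be a mollifier and let h, ℓ > 0 be adapted to χ. Then for every β > 0 there exist constants γ > 0 and C > 0 such that for every j ∈ {1,2,3}, every 0 < λ < 1, and all finite Borel measures ρ, ρ′ on ℝ³ satisfying ρ({y ∈ ℝ³ : |y_j − x^λ((χ*ρ)_j)| ≤ ℓ}) ≥ β and ‖ρ′ − ρ‖_TV ≤ γ, one has |x^λ((χ*ρ′)_j) − x^λ((χ*ρ)_j)| ≤ C·‖ρ′ − ρ‖_TV. -/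
open MeasureTheory Measure Set Metric Filter
open scoped ENNReal NNReal RealInnerProductSpace BigOperators FourierTransform

noncomputable section

/-- Euclidean space `ℝ³`. -/
abbrev E3 := EuclideanSpace ℝ (Fin 3)

/-- A mollifier on `ℝ³`: a smooth, compactly supported, `[0,1]`-valued function with
integral one. -/
structure IsMollifier (χ : E3 → ℝ) : Prop where
  smooth : ContDiff ℝ (⊤ : ℕ∞) χ
  compactSupport : HasCompactSupport χ
  mem_Icc : ∀ y, χ y ∈ Set.Icc (0:ℝ) 1
  integral_one : (∫ y, χ y) = 1

/-- Rotation invariance of a function on `ℝ³`. -/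
def RotInv (g : E3 → ℝ) : Prop := ∀ x y : E3, ‖x‖ = ‖y‖ → g x = g y

/-- The `λ`-quantile `x^λ(ν) = sup {t : ν(-∞,t] ≤ λ·ν(ℝ)}` of a (finite Borel) measure on `ℝ`. -/
def quantile (ν : Measure ℝ) (lam : ℝ) : ℝ :=
  sSup {t : ℝ | (ν (Set.Iic t)).toReal ≤ lam * (ν Set.univ).toReal}

/-- The `j`-th marginal of a measure on `ℝ³`. -/
def marg (ρ : Measure E3) (j : Fin 3) : Measure ℝ := ρ.map (fun y => y j)

/-- The mollification `χ*ρ` of a measure `ρ` on `ℝ³`: the measure with Lebesgue density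
`x ↦ ∫ χ(x-y) dρ(y)`. -/
def mollify (χ : E3 → ℝ) (ρ : Measure E3) : Measure E3 :=
  volume.withDensity fun x => ENNReal.ofReal (∫ y, χ (x - y) ∂ρ)

/-- The `λ`-quantile `x^λ((χ*ρ)_j)` of the `j`-th marginal of the mollified measure. -/
def qtl (χ : E3 → ℝ) (ρ : Measure E3) (j : Fin 3) (lam : ℝ) : ℝ :=
  quantile (marg (mollify χ ρ) j) lam

/-- The function `f^χ_{j,t}(y) = ∫ χ(z)·1_{(-∞,t]}(y_j - z_j) dz`. -/
def fchi (χ : E3 → ℝ) (j : Fin 3) (t : ℝ) (y : E3) : ℝ :=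
  ∫ z, χ z * Set.indicator (Set.Iic t) (fun _ => (1:ℝ)) (y j - z j)

/-- The `j`-th standard basis vector of `ℝ³`. -/
def esingle (j : Fin 3) : E3 := EuclideanSpace.single j (1:ℝ)

/-- Constants `h, ℓ > 0` are adapted to `χ` if
`-∂_{y_j} f^χ_{j,t}(y) ≥ h·1_{(t-2ℓ,t+2ℓ)}(y_j)` for all `t, y, j`. -/
def Adapted (χ : E3 → ℝ) (h ℓ : ℝ) : Prop :=
  ∀ (j : Fin 3) (t : ℝ) (y : E3),
    h * Set.indicator (Set.Ioo (t - 2*ℓ) (t + 2*ℓ)) (fun _ => (1:ℝ)) (y j)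
      ≤ - fderiv ℝ (fchi χ j t) y (esingle j)

/-- Total variation distance `‖μ - ν‖_TV` of two finite measures. -/
def tv (μ ν : Measure E3) [IsFiniteMeasure μ] [IsFiniteMeasure ν] : ℝ :=
  ((μ.toSignedMeasure - ν.toSignedMeasure).totalVariation Set.univ).toReal

/-- Mollified total variation `‖g*(μ - ν)‖_TV`, i.e. the `L¹` norm of the difference of the
Lebesgue densities of `g*μ` and `g*ν`. -/
def tvMol (g : E3 → ℝ) (μ ν : Measure E3) : ℝ :=
  ∫ x, |(∫ y, g (x - y) ∂μ) - (∫ y, g (x - y) ∂ν)|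

/-- One component of the regularized median of a measure on `ℝ`:
the mean over the quantile window `[x^{1/2-q}, x^{1/2+q}]`. -/
def medComp (q : ℝ) (ν : Measure ℝ) : ℝ :=
  (∫ t in Set.Icc (quantile ν (1/2 - q)) (quantile ν (1/2 + q)), t ∂ν)
    / (ν (Set.Icc (quantile ν (1/2 - q)) (quantile ν (1/2 + q)))).toReal

/-- Assemble a vector of `ℝ³` from its coordinates. -/
def vec3 (f : Fin 3 → ℝ) : E3 := (EuclideanSpace.equiv (Fin 3) ℝ).symm f

/-- The regularized median `m_q(ρ) ∈ ℝ³` (componentwise over the marginals;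
by the junk-value conventions `m_q(0) = 0`). -/
def med (q : ℝ) (ρ : Measure E3) : E3 := vec3 fun j => medComp q (marg ρ j)

/-- The function `H^χ_{q,ρ₀} = (H₁,H₂,H₃) : ℝ³ → ℝ³` (componentwise). -/
def Hfun (χ : E3 → ℝ) (q : ℝ) (ρ₀ : Measure E3) (j : Fin 3) (y : E3) : ℝ :=
  (2 * q * (ρ₀ Set.univ).toReal)⁻¹ *
    ((∫ z, χ z *
        Set.indicator (Set.Icc (qtl χ ρ₀ j (1/2 - q)) (qtl χ ρ₀ j (1/2 + q)))
          (fun _ => (1:ℝ)) (y j - z j) *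
        (y j - z j - medComp q (marg (mollify χ ρ₀) j)))
      + (qtl χ ρ₀ j (1/2 + q) - medComp q (marg (mollify χ ρ₀) j))
          * (1/2 + q - fchi χ j (qtl χ ρ₀ j (1/2 + q)) y)
      + (medComp q (marg (mollify χ ρ₀) j) - qtl χ ρ₀ j (1/2 - q))
          * (1/2 - q - fchi χ j (qtl χ ρ₀ j (1/2 - q)) y))

/-- Mass and pair-correlation conditions `d ≤ ν(ℝ³) ≤ D`, `∬_{|x-y|>R} dν dν ≤ δ`. -/
def MassCond (d D δ R : ℝ) (ν : Measure E3) : Prop :=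
  d ≤ (ν Set.univ).toReal ∧ (ν Set.univ).toReal ≤ D ∧
    ((ν.prod ν) {p : E3 × E3 | R < dist p.1 p.2}).toReal ≤ δ

/-- Admissible triple `(ρ₀, ρ, ρ')` of measures on `ℝ³` (w.r.t. the mollifier `χ` and the
constants `q, ℓ, β, d, D, δ, R, R'`). -/
def Admissible (χ : E3 → ℝ) (q ℓ β d D δ R R' : ℝ) (ρ₀ ρ ρ' : Measure E3) : Prop :=
  (∃ qt : ℝ, 0 < qt ∧ qt ≤ q ∧
      ‖med qt ρ' - med qt ρ‖ + ‖med qt ρ - med qt ρ₀‖ ≤ R') ∧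
  MassCond d D δ R ρ₀ ∧ MassCond d D δ R ρ ∧ MassCond d D δ R ρ' ∧
  (∀ j : Fin 3,
    β ≤ (ρ₀ {y : E3 | |y j - qtl χ ρ₀ j (1/2 + q)| ≤ ℓ}).toReal ∧
    β ≤ (ρ₀ {y : E3 | |y j - qtl χ ρ₀ j (1/2 - q)| ≤ ℓ}).toReal)

/-- Convolution of two scalar functions on `ℝ³`. -/
def convFn (g₁ g₂ : E3 → ℝ) (x : E3) : ℝ := ∫ z, g₁ z * g₂ (x - z)

/-- Convolution of a scalar kernel with a vector-valued function on `ℝ³`. -/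
def convVec (k : E3 → ℝ) (F : E3 → E3) (y : E3) : E3 := ∫ z, k z • F (y - z)

/-- The boost function `𝓑(ρ) = m_q(χ*ρ) + ∫ f(y - m_q(χ*ρ)) dρ(y)`. -/
def Bfun (χ : E3 → ℝ) (q : ℝ) (f : E3 → E3) (ρ : Measure E3) : E3 :=
  med q (mollify χ ρ) + ∫ y, f (y - med q (mollify χ ρ)) ∂ρ

/-- `f ∈ C_b²(ℝ³,ℝ³)`: twice continuously differentiable with bounded derivatives
up to order two. -/
def CB2 (f : E3 → E3) : Prop :=
  ContDiff ℝ 2 f ∧ ∃ M : ℝ, ∀ y : E3,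
    ‖f y‖ ≤ M ∧ ‖fderiv ℝ f y‖ ≤ M ∧ ‖fderiv ℝ (fderiv ℝ f) y‖ ≤ M

/-- The polaron interaction `v(y) = π^{-3/2}|y|^{-2}`. -/
def vPol (y : E3) : ℝ := Real.pi ^ (-(3:ℝ)/2) * ‖y‖ ^ (-(2:ℝ))

/-- `h_ψ = |ψ|² * v`. -/
def hPek (ψ : E3 → ℂ) (x : E3) : ℝ := ∫ y, vPol (x - y) * ‖ψ y‖^2

/-- The Pekar energy
`𝓔(ψ,φ) = ‖φ‖² + ‖∇ψ‖² - 2∬ v(x-y)·Re φ(y)·|ψ(x)|² dx dy`. -/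
def PekarE (ψ φm : E3 → ℂ) : ℝ :=
  (∫ x, ‖φm x‖^2) + (∫ x, ‖fderiv ℝ ψ x‖^2)
    - 2 * ∫ pr : E3 × E3, vPol (pr.1 - pr.2) * (φm pr.2).re * ‖ψ pr.1‖^2
        ∂((volume : Measure E3).prod (volume : Measure E3))

/-- The Fourier transform of `v^Λ = χ(|∇| ≤ Λ)v`, namely
`k ↦ (2π)^{-1/2}|k|^{-1}·1_{|k| ≤ Λ}`. -/
def VLam (Λ : ℝ) (k : E3) : ℝ :=
  Set.indicator {k : E3 | ‖k‖ ≤ Λ} (fun k => (2 * Real.pi) ^ (-(1:ℝ)/2) * ‖k‖⁻¹) k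

/-- The Fourier transform of `w^Λ = (i∇/Δ)χ(|∇| > Λ)v`, namely
`k ↦ (2π)^{-1/2}|k|^{-3}·k·1_{|k| > Λ}`. -/
def WLam (Λ : ℝ) (k : E3) : E3 :=
  Set.indicator {k : E3 | Λ < ‖k‖} (fun k => ((2 * Real.pi) ^ (-(1:ℝ)/2) * (‖k‖^3)⁻¹) • k) k

/-- Pair correlation functional `∬_{|x-y| > R*} dρ(x) dρ(y)`. -/
def pairF (Rstar : ℝ) (ρ : Measure E3) : ℝ :=
  ((ρ.prod ρ) {p : E3 × E3 | Rstar < dist p.1 p.2}).toReal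

/-- The smooth cut-off functional
`F(ρ) = β₁(((ρ(ℝ³)-a)² + (∬_{|x-y|>R*}dρdρ - δ*)² - σ²)/κ²)`. -/
def Fcut (a Rstar δstar κ σ : ℝ) (β₁ : ℝ → ℝ) (ρ : Measure E3) : ℝ :=
  β₁ ((((ρ Set.univ).toReal - a)^2 + (pairF Rstar ρ - δstar)^2 - σ^2) / κ^2)


/-- Stability of the supremum of a sublevel set under a uniform perturbation, for monotone functions
growing at a linear rate near that supremum. -/
lemma abs_sSup_sublevel_sub_le {F F' : ℝ → ℝ} {a a' k ℓ τ : ℝ} (hF : Monotone F)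
    (hF' : Monotone F') (hk : 0 < k) (hτ0 : 0 ≤ τ) (hτ : τ / k < ℓ)
    (hne : {t | F t ≤ a}.Nonempty) (hbdd : BddAbove {t | F t ≤ a})
    (hslope : ∀ u v, sSup {t | F t ≤ a} - ℓ < u → u ≤ v → v < sSup {t | F t ≤ a} + ℓ →
      k * (v - u) ≤ F v - F u)
    (hclose : ∀ t, |(F' t - a') - (F t - a)| ≤ τ) :
    |sSup {t | F' t ≤ a'} - sSup {t | F t ≤ a}| ≤ τ / k := by
  set x := sSup {t | F t ≤ a}
  have hτk : 0 ≤ τ / k := div_nonneg hτ0 hk.le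
  have hbelow : ∀ t, t < x → F t ≤ a := fun t ht => by
    obtain ⟨s, hs, hts⟩ := exists_lt_of_lt_csSup hne ht
    exact (hF hts.le).trans hs
  have habove : ∀ t, x < t → a < F t := fun t ht => by
    by_contra! hc
    exact absurd (le_csSup hbdd hc) (not_le.2 ht)
  have hlow : ∀ t, x - ℓ < t → t < x → k * (x - t) ≤ a - F t := by
    intro t ht htx
    rw [mul_comm, ← le_div_iff₀ hk, _root_.sub_le_iff_le_add]
    refine le_of_forall_lt_imp_le_of_dense fun w hw => ?_
    rw [← _root_.sub_le_iff_le_add, le_div_iff₀ hk]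
    rcases le_total w t with hwt | hwt
    · nlinarith [hbelow t htx, mul_nonneg hk.le (sub_nonneg.2 hwt)]
    · nlinarith [hslope t w ht hwt (by linarith), hbelow w hw]
  have hhigh : ∀ t, x < t → t < x + ℓ → k * (t - x) ≤ F t - a := by
    intro t hxt ht
    rw [mul_comm, ← le_div_iff₀ hk, sub_le_comm]
    refine le_of_forall_gt_imp_ge_of_dense fun w hw => ?_
    rw [sub_le_comm, le_div_iff₀ hk]
    rcases le_total t w with hwt | hwt
    · nlinarith [habove t hxt, mul_nonneg hk.le (sub_nonneg.2 hwt)]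
    · nlinarith [hslope w t (by linarith) hwt ht, habove w hw]
  have hmem : ∀ t, x - ℓ < t → t < x - τ / k → F' t ≤ a' := by
    intro t ht htx
    have h1 := hlow t ht (by linarith)
    have h2 : τ < k * (x - t) := by
      rw [mul_comm, ← div_lt_iff₀ hk]; linarith
    linarith [(abs_le.1 (hclose t)).2]
  have hub : ∀ t, F' t ≤ a' → t ≤ x + τ / k := by
    intro t ht
    by_contra! hc
    obtain ⟨s, hs1, hs2⟩ := exists_between (lt_min hc (by linarith : x + τ / k < x + ℓ))
    have h1 := hhigh s (by linarith) (hs2.trans_le (min_le_right _ _))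
    have h2 : τ < k * (s - x) := by
      rw [mul_comm, ← div_lt_iff₀ hk]; linarith
    have h3 := hF' (hs2.le.trans (min_le_left _ _))
    linarith [(abs_le.1 (hclose s)).1]
  obtain ⟨r, hr1, hr2⟩ := exists_between (by linarith : x - ℓ < x - τ / k)
  have hlower : x - τ / k ≤ sSup {t | F' t ≤ a'} := by
    refine le_of_forall_lt_imp_le_of_dense fun w hw => ?_
    exact (le_max_left w r).trans (le_csSup ⟨_, hub⟩
      (hmem _ (hr1.trans_le (le_max_right _ _)) (max_lt hw hr2)))
  have hupper : sSup {t | F' t ≤ a'} ≤ x + τ / k := csSup_le ⟨r, hmem r hr1 hr2⟩ hub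
  rw [abs_le]
  constructor <;> linarith

/-- The integral of a function bounded by one against a difference of finite measures is bounded by
the total variation of that difference. -/
lemma abs_integral_sub_integral_le_tv (μ ν : Measure E3) [IsFiniteMeasure μ] [IsFiniteMeasure ν]
    {φ : E3 → ℝ} (hφm : Measurable φ) (hφ : ∀ y, |φ y| ≤ 1) :
    |(∫ y, φ y ∂μ) - ∫ y, φ y ∂ν| ≤ tv μ ν := by
  set s := μ.toSignedMeasure - ν.toSignedMeasure
  set p := s.toJordanDecomposition.posPart
  set n := s.toJordanDecomposition.negPart
  have hsum : μ + n = ν + p := by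
    rw [← toSignedMeasure_eq_toSignedMeasure_iff, toSignedMeasure_add, toSignedMeasure_add]
    have h1 : p.toSignedMeasure - n.toSignedMeasure = s :=
      s.toSignedMeasure_toJordanDecomposition
    rw [add_comm ν.toSignedMeasure, ← sub_eq_sub_iff_add_eq_add]
    exact h1.symm
  have hint : ∀ (κ : Measure E3) [IsFiniteMeasure κ], Integrable φ κ := fun κ _ =>
    Integrable.of_bound hφm.aestronglyMeasurable 1 (.of_forall hφ)
  have hbd : ∀ (κ : Measure E3) [IsFiniteMeasure κ], |∫ y, φ y ∂κ| ≤ κ.real univ := by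
    intro κ _
    have h := norm_integral_le_of_norm_le_const (μ := κ) (f := φ) (C := 1) (.of_forall hφ)
    rwa [Real.norm_eq_abs, one_mul] at h
  have hI : (∫ y, φ y ∂μ) + ∫ y, φ y ∂n = (∫ y, φ y ∂ν) + ∫ y, φ y ∂p := by
    rw [← integral_add_measure (hint μ) (hint n), ← integral_add_measure (hint ν) (hint p), hsum]
  have htv : tv μ ν = p.real univ + n.real univ := by
    rw [tv, SignedMeasure.totalVariation, ← measureReal_def, measureReal_add_apply]
  rw [htv, show (∫ y, φ y ∂μ) - ∫ y, φ y ∂ν = (∫ y, φ y ∂p) - ∫ y, φ y ∂n by linarith]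
  exact (abs_sub _ _).trans (add_le_add (hbd p) (hbd n))

/-- The probability measure with Lebesgue density `χ`. -/
def mollifierMeasure (χ : E3 → ℝ) : Measure E3 :=
  volume.withDensity fun z => ENNReal.ofReal (χ z)

/-- The distribution function of the `j`-th coordinate under the density `χ`. -/
def mollifierCDF (χ : E3 → ℝ) (j : Fin 3) (u : ℝ) : ℝ :=
  (mollifierMeasure χ).real {z | z j ≤ u}

lemma measurable_coord (j : Fin 3) : Measurable fun y : E3 => y j :=
  (EuclideanSpace.proj (𝕜 := ℝ) j).continuous.measurable

lemma volume_coord_eq (j : Fin 3) (c : ℝ) : volume {z : E3 | z j = c} = 0 := by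
  have h := (PiLp.volume_preserving_ofLp (Fin 3)).measure_preimage
    (s := {z : Fin 3 → ℝ | z j = c})
    (measurableSet_eq_fun (measurable_pi_apply j) measurable_const).nullMeasurableSet
  rw [volume_pi, pi_hyperplane] at h
  exact h

namespace IsMollifier

variable {χ : E3 → ℝ}

lemma integrable (hχ : IsMollifier χ) : Integrable χ :=
  hχ.smooth.continuous.integrable_of_hasCompactSupport hχ.compactSupport

lemma measurable (hχ : IsMollifier χ) : Measurable χ := hχ.smooth.continuous.measurable

lemma isProbabilityMeasure (hχ : IsMollifier χ) : IsProbabilityMeasure (mollifierMeasure χ) := by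
  refine ⟨?_⟩
  rw [mollifierMeasure, withDensity_apply _ MeasurableSet.univ, Measure.restrict_univ,
    ← ofReal_integral_eq_lintegral_ofReal hχ.integrable (.of_forall fun z => (hχ.mem_Icc z).1),
    hχ.integral_one, ENNReal.ofReal_one]

lemma monotone_mollifierCDF (hχ : IsMollifier χ) (j : Fin 3) : Monotone (mollifierCDF χ j) := by
  have := hχ.isProbabilityMeasure
  exact fun u v huv => measureReal_mono fun z (hz : z j ≤ u) => hz.trans huv

lemma mollifierCDF_mem_Icc (hχ : IsMollifier χ) (j : Fin 3) (u : ℝ) :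
    mollifierCDF χ j u ∈ Icc (0 : ℝ) 1 := by
  have := hχ.isProbabilityMeasure
  exact ⟨measureReal_nonneg, measureReal_le_one⟩

lemma mollifierCDF_eq_cdf (hχ : IsMollifier χ) (j : Fin 3) :
    mollifierCDF χ j = ProbabilityTheory.cdf ((mollifierMeasure χ).map fun z => z j) := by
  have := hχ.isProbabilityMeasure
  have := isProbabilityMeasure_map (μ := mollifierMeasure χ) (measurable_coord j).aemeasurable
  ext u
  rw [ProbabilityTheory.cdf_eq_real, map_measureReal_apply (measurable_coord j) measurableSet_Iic]
  rfl

lemma fchi_eq (hχ : IsMollifier χ) (j : Fin 3) (t : ℝ) (y : E3) :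
    fchi χ j t y = 1 - mollifierCDF χ j (y j - t) := by
  have := hχ.isProbabilityMeasure
  have hm : MeasurableSet {z : E3 | z j ≤ y j - t} := measurable_coord j measurableSet_Iic
  have hreal : mollifierCDF χ j (y j - t) = ∫ z in {z : E3 | z j ≤ y j - t}, χ z := by
    rw [mollifierCDF, measureReal_def, mollifierMeasure, withDensity_apply _ hm,
      ← ofReal_integral_eq_lintegral_ofReal hχ.integrable.integrableOn
        (.of_forall fun z => (hχ.mem_Icc z).1),
      ENNReal.toReal_ofReal (integral_nonneg fun z => (hχ.mem_Icc z).1)]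
  rw [hreal, ← hχ.integral_one, ← integral_add_compl hm hχ.integrable, add_sub_cancel_left,
    ← integral_indicator hm.compl, fchi]
  refine integral_congr_ae ?_
  have hnull : ∀ᵐ z : E3, z j ≠ y j - t := by
    rw [ae_iff]; simpa using volume_coord_eq j (y j - t)
  filter_upwards [hnull] with z hz
  by_cases hc : z j ≤ y j - t
  · have h1 : ¬ (y j - z j ≤ t) := fun h2 => hz (by linarith)
    simp [hc, h1]
  · have h1 : y j - z j ≤ t := by linarith
    simp [hc, h1]

lemma mollifierCDF_slope (hχ : IsMollifier χ) {h ℓ : ℝ} (hh : 0 < h) (hadapt : Adapted χ h ℓ)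
    (j : Fin 3) {u v : ℝ} (hu : -(2 * ℓ) < u) (huv : u ≤ v) (hv : v < 2 * ℓ) :
    h * (v - u) ≤ mollifierCDF χ j v - mollifierCDF χ j u := by
  have hcoord : ∀ s : ℝ, (s • esingle j) j = s := fun s => by simp [esingle]
  have hderiv : ∀ s ∈ Ioo (-(2 * ℓ)) (2 * ℓ), ∃ d, h ≤ d ∧ HasDerivAt (mollifierCDF χ j) d s := by
    intro s hs
    have h1 := hadapt j 0 (s • esingle j)
    rw [hcoord, indicator_of_mem (by constructor <;> linarith [hs.1, hs.2]), mul_one] at h1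
    refine ⟨_, h1, ?_⟩
    have hdiff : DifferentiableAt ℝ (fchi χ j 0) (s • esingle j) := by
      by_contra hc
      rw [fderiv_zero_of_not_differentiableAt hc] at h1
      simp at h1
      linarith
    have h2 : HasDerivAt (fun r : ℝ => r • esingle j) (esingle j) s := by
      simpa using (hasDerivAt_id s).smul_const (esingle j)
    have h3 := (hdiff.hasFDerivAt.comp_hasDerivAt s h2).const_sub 1
    refine h3.congr_of_eventuallyEq (.of_forall fun r => ?_)
    simp only [Function.comp_apply, hχ.fchi_eq, hcoord, sub_zero, sub_sub_cancel]
  have hsub : Icc u v ⊆ Ioo (-(2 * ℓ)) (2 * ℓ) := Icc_subset_Ioo hu hv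
  refine (convex_Icc u v).mul_sub_le_image_sub_of_le_deriv ?_ ?_ ?_ u (left_mem_Icc.2 huv) v
    (right_mem_Icc.2 huv) huv
  · intro s hs
    obtain ⟨d, -, hd⟩ := hderiv s (hsub hs)
    exact hd.continuousAt.continuousWithinAt
  · intro s hs
    obtain ⟨d, -, hd⟩ := hderiv s (hsub (interior_subset hs))
    exact hd.differentiableAt.differentiableWithinAt
  · intro s hs
    obtain ⟨d, hhd, hd⟩ := hderiv s (hsub (interior_subset hs))
    rwa [hd.deriv]

lemma mollify_apply (hχ : IsMollifier χ) (ρ : Measure E3) [IsFiniteMeasure ρ] {A : Set E3}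
    (hA : MeasurableSet A) :
    mollify χ ρ A = ∫⁻ y, mollifierMeasure χ ((fun z => z + y) ⁻¹' A) ∂ρ := by
  have hm : Measurable fun q : E3 × E3 => ENNReal.ofReal (χ (q.1 - q.2)) :=
    (hχ.measurable.comp (measurable_fst.sub measurable_snd)).ennreal_ofReal
  have hdens : ∀ x, ENNReal.ofReal (∫ y, χ (x - y) ∂ρ) = ∫⁻ y, ENNReal.ofReal (χ (x - y)) ∂ρ := by
    intro x
    refine ofReal_integral_eq_lintegral_ofReal ?_ (.of_forall fun z => (hχ.mem_Icc _).1)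
    refine Integrable.of_bound
      (hχ.measurable.comp (measurable_const.sub measurable_id)).aestronglyMeasurable 1
      (.of_forall fun z => ?_)
    rw [Real.norm_eq_abs, abs_le]
    exact ⟨by linarith [(hχ.mem_Icc (x - z)).1], (hχ.mem_Icc (x - z)).2⟩
  simp only [mollify, hdens]
  rw [withDensity_apply _ hA, lintegral_lintegral_swap hm.aemeasurable]
  refine lintegral_congr fun y => ?_
  have hA' : MeasurableSet ((fun z => z + y) ⁻¹' A) := measurable_add_const y hA
  rw [mollifierMeasure, withDensity_apply _ hA', ← lintegral_indicator hA,
    ← lintegral_indicator hA', ← lintegral_add_right_eq_self _ y]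
  refine lintegral_congr fun z => ?_
  simp only [indicator, add_sub_cancel_right]
  rfl

lemma marg_mollify_univ (hχ : IsMollifier χ) (ρ : Measure E3) [IsFiniteMeasure ρ] (j : Fin 3) :
    marg (mollify χ ρ) j univ = ρ univ := by
  have := hχ.isProbabilityMeasure
  rw [marg, map_apply (measurable_coord j) MeasurableSet.univ, preimage_univ,
    hχ.mollify_apply ρ MeasurableSet.univ]
  simp

lemma measurable_mollifierCDF_sub (hχ : IsMollifier χ) (j : Fin 3) (t : ℝ) :
    Measurable fun y : E3 => mollifierCDF χ j (t - y j) :=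
  (hχ.monotone_mollifierCDF j).measurable.comp (measurable_const.sub (measurable_coord j))

lemma marg_mollify_Iic (hχ : IsMollifier χ) (ρ : Measure E3) [IsFiniteMeasure ρ] (j : Fin 3)
    (t : ℝ) :
    (marg (mollify χ ρ) j (Iic t)).toReal = ∫ y, mollifierCDF χ j (t - y j) ∂ρ := by
  have := hχ.isProbabilityMeasure
  have hset : MeasurableSet ((fun y : E3 => y j) ⁻¹' Iic t) := measurable_coord j measurableSet_Iic
  rw [marg, map_apply (measurable_coord j) measurableSet_Iic, hχ.mollify_apply ρ hset,
    integral_eq_lintegral_of_nonneg_ae (.of_forall fun y => (hχ.mollifierCDF_mem_Icc j _).1)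
      (hχ.measurable_mollifierCDF_sub j t).aestronglyMeasurable]
  congr 1
  refine lintegral_congr fun y => ?_
  rw [mollifierCDF, ofReal_measureReal]
  congr 1
  ext z
  simp [le_sub_iff_add_le]

lemma integrable_mollifierCDF_sub (hχ : IsMollifier χ) (ρ : Measure E3) [IsFiniteMeasure ρ]
    (j : Fin 3) (t : ℝ) : Integrable (fun y : E3 => mollifierCDF χ j (t - y j)) ρ := by
  refine Integrable.of_bound (hχ.measurable_mollifierCDF_sub j t).aestronglyMeasurable 1
    (.of_forall fun y => ?_)
  rw [Real.norm_of_nonneg (hχ.mollifierCDF_mem_Icc j _).1]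
  exact (hχ.mollifierCDF_mem_Icc j _).2

lemma monotone_integral_mollifierCDF (hχ : IsMollifier χ) (ρ : Measure E3) [IsFiniteMeasure ρ]
    (j : Fin 3) : Monotone fun t => ∫ y, mollifierCDF χ j (t - y j) ∂ρ := fun s t hst =>
  integral_mono (hχ.integrable_mollifierCDF_sub ρ j s) (hχ.integrable_mollifierCDF_sub ρ j t)
    fun y => hχ.monotone_mollifierCDF j (by linarith)

lemma tendsto_integral_mollifierCDF (hχ : IsMollifier χ) (ρ : Measure E3) [IsFiniteMeasure ρ]
    (j : Fin 3) {l : Filter ℝ} [l.IsCountablyGenerated] {c : ℝ}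
    (hl : ∀ y : E3, Tendsto (fun t => mollifierCDF χ j (t - y j)) l (nhds c)) :
    Tendsto (fun t => ∫ y, mollifierCDF χ j (t - y j) ∂ρ) l (nhds (c * ρ.real univ)) := by
  have h := tendsto_integral_filter_of_dominated_convergence (μ := ρ) (l := l)
    (F := fun t y => mollifierCDF χ j (t - y j)) (f := fun _ => c) (fun _ => (1 : ℝ))
    (.of_forall fun t => (hχ.measurable_mollifierCDF_sub j t).aestronglyMeasurable)
    (.of_forall fun t => .of_forall fun y => by
      rw [Real.norm_of_nonneg (hχ.mollifierCDF_mem_Icc j _).1]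
      exact (hχ.mollifierCDF_mem_Icc j _).2)
    (integrable_const 1) (.of_forall hl)
  simpa [mul_comm] using h

lemma sublevel_nonempty (hχ : IsMollifier χ) (ρ : Measure E3) [IsFiniteMeasure ρ] (j : Fin 3)
    {a : ℝ} (ha : 0 < a) : {t | ∫ y, mollifierCDF χ j (t - y j) ∂ρ ≤ a}.Nonempty := by
  have h := hχ.tendsto_integral_mollifierCDF ρ j (l := atBot) (c := 0) fun y => by
    rw [hχ.mollifierCDF_eq_cdf j]
    exact (ProbabilityTheory.tendsto_cdf_atBot _).comp
      (tendsto_atBot_add_const_right _ (-y j) tendsto_id)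
  rw [zero_mul] at h
  exact (h.eventually_le_const ha).exists

lemma sublevel_bddAbove (hχ : IsMollifier χ) (ρ : Measure E3) [IsFiniteMeasure ρ] (j : Fin 3)
    {a : ℝ} (ha : a < ρ.real univ) :
    BddAbove {t | ∫ y, mollifierCDF χ j (t - y j) ∂ρ ≤ a} := by
  have h := hχ.tendsto_integral_mollifierCDF ρ j (l := atTop) (c := 1) fun y => by
    rw [hχ.mollifierCDF_eq_cdf j]
    exact (ProbabilityTheory.tendsto_cdf_atTop _).comp
      (tendsto_atTop_add_const_right _ (-y j) tendsto_id)
  rw [one_mul] at h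
  obtain ⟨b, hb⟩ := (h.eventually_const_lt ha).exists
  refine ⟨b, fun t ht => ?_⟩
  by_contra! hbt
  exact absurd (hχ.monotone_integral_mollifierCDF ρ j hbt.le) (not_le.2 (lt_of_le_of_lt ht hb))

lemma qtl_eq (hχ : IsMollifier χ) (ρ : Measure E3) [IsFiniteMeasure ρ] (j : Fin 3) (lam : ℝ) :
    qtl χ ρ j lam = sSup {t | ∫ y, mollifierCDF χ j (t - y j) ∂ρ ≤ lam * ρ.real univ} := by
  simp only [qtl, quantile, hχ.marg_mollify_Iic, hχ.marg_mollify_univ, measureReal_def]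

lemma integral_mollifierCDF_slope (hχ : IsMollifier χ) {h ℓ : ℝ} (hh : 0 < h)
    (hadapt : Adapted χ h ℓ) (ρ : Measure E3) [IsFiniteMeasure ρ] (j : Fin 3) {x u v : ℝ}
    (hu : x - ℓ < u) (huv : u ≤ v) (hv : v < x + ℓ) :
    h * (v - u) * ρ.real {y : E3 | |y j - x| ≤ ℓ} ≤
      (∫ y, mollifierCDF χ j (v - y j) ∂ρ) - ∫ y, mollifierCDF χ j (u - y j) ∂ρ := by
  have hS : MeasurableSet {y : E3 | |y j - x| ≤ ℓ} :=
    measurableSet_le ((measurable_coord j).sub measurable_const).abs measurable_const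
  rw [← integral_sub (hχ.integrable_mollifierCDF_sub ρ j v)
    (hχ.integrable_mollifierCDF_sub ρ j u), mul_comm, ← smul_eq_mul, ← integral_indicator_const _ hS]
  refine integral_mono ((integrable_const _).indicator hS)
    ((hχ.integrable_mollifierCDF_sub ρ j v).sub (hχ.integrable_mollifierCDF_sub ρ j u)) fun y => ?_
  by_cases hy : |y j - x| ≤ ℓ
  · rw [indicator_of_mem (show y ∈ {y : E3 | |y j - x| ≤ ℓ} from hy)]
    have hy' := abs_le.1 hy
    have := hχ.mollifierCDF_slope hh hadapt j (u := u - y j) (v := v - y j)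
      (by linarith) (by linarith) (by linarith)
    simpa using this
  · rw [indicator_of_notMem (show y ∉ {y : E3 | |y j - x| ≤ ℓ} from hy)]
    exact sub_nonneg.2 (hχ.monotone_mollifierCDF j (by linarith))

end IsMollifier

/-- quantile stability under total variation perturbations. -/
theorem stmt0 (χ : E3 → ℝ) (hχ : IsMollifier χ) (h ℓ : ℝ) (hh : 0 < h) (hℓ : 0 < ℓ)
    (hadapt : Adapted χ h ℓ) :
    ∀ β : ℝ, 0 < β → ∃ γ > (0:ℝ), ∃ C > (0:ℝ),
      ∀ (j : Fin 3) (lam : ℝ), 0 < lam → lam < 1 →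
        ∀ (ρ ρ' : Measure E3) [IsFiniteMeasure ρ] [IsFiniteMeasure ρ'],
          β ≤ (ρ {y : E3 | |y j - qtl χ ρ j lam| ≤ ℓ}).toReal →
          tv ρ' ρ ≤ γ →
          |qtl χ ρ' j lam - qtl χ ρ j lam| ≤ C * tv ρ' ρ := by
  intro β hβ
  have hk : 0 < h * β := mul_pos hh hβ
  refine ⟨h * β * ℓ / 2, by positivity, (h * β)⁻¹, by positivity, ?_⟩
  intro j lam h0 h1 ρ ρ' _ _ hmass htv
  rw [← measureReal_def] at hmass
  have hM : 0 < ρ.real univ := hβ.trans_le (hmass.trans (measureReal_mono (subset_univ _)))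
  rw [hχ.qtl_eq] at hmass
  rw [hχ.qtl_eq, hχ.qtl_eq, mul_comm (h * β)⁻¹, ← div_eq_mul_inv]
  refine abs_sSup_sublevel_sub_le (ℓ := ℓ) (hχ.monotone_integral_mollifierCDF ρ j)
    (hχ.monotone_integral_mollifierCDF ρ' j) hk ENNReal.toReal_nonneg ?_
    (hχ.sublevel_nonempty ρ j (mul_pos h0 hM))
    (hχ.sublevel_bddAbove ρ j (mul_lt_of_lt_one_left hM h1)) ?_ ?_
  · rw [div_lt_iff₀ hk]
    nlinarith [mul_pos hk hℓ]
  · intro u v hu huv hv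
    refine le_trans ?_ (hχ.integral_mollifierCDF_slope hh hadapt ρ j hu huv hv)
    nlinarith [mul_le_mul_of_nonneg_left hmass (mul_nonneg hh.le (sub_nonneg.2 huv))]
  · intro t
    have hint : ∀ (κ : Measure E3) [IsFiniteMeasure κ],
        (∫ y, mollifierCDF χ j (t - y j) ∂κ) - lam * κ.real univ
          = ∫ y, (mollifierCDF χ j (t - y j) - lam) ∂κ := fun κ _ => by
      rw [integral_sub (hχ.integrable_mollifierCDF_sub κ j t) (integrable_const _)]
      simp [mul_comm]
    rw [hint, hint]
    refine abs_integral_sub_integral_le_tv ρ' ρ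
      ((hχ.measurable_mollifierCDF_sub j t).sub measurable_const) fun y => ?_
    have := hχ.mollifierCDF_mem_Icc j (t - y j)
    rw [abs_le]
    constructor <;> linarith [this.1, this.2]

end
end

section
/- Let g : ℝ³ → [0,1] be a rotation-invariant mollifier, set χ := g*g, and let h, ℓ > 0 be adapted to g. Fix 0 < q < 1/2 and β, d, D, δ, R, R′ > 0 with 0 < δ < d²/2 and q ≤ 1/2 − δ/d². Then there exists a constant C > 0 such that for every admissible triple (ρ₀, ρ, ρ′) (with the quantile-mass windows of radius ℓ), setting H := H^χ_{q,ρ₀}, one has |m_q(χ*ρ) + ∫ H d(ρ′ − ρ) − m_q(χ*ρ′)| ≤ C·‖g*(ρ′ − ρ)‖_TV·(‖g*(ρ′ − ρ)‖_TV + ‖g*(ρ − ρ₀)‖_TV). -/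
open MeasureTheory Measure Set Metric Filter
open scoped ENNReal NNReal RealInnerProductSpace BigOperators FourierTransform

noncomputable section

/-- The quantile splits the mass of a finite measure at the prescribed level. -/
theorem quantile_spec (ν : Measure ℝ) [IsFiniteMeasure ν] (hN : 0 < ν.real univ)
    {lam : ℝ} (h0 : 0 < lam) (h1 : lam < 1) :
    ν.real (Iio (quantile ν lam)) ≤ lam * ν.real univ ∧
      lam * ν.real univ ≤ ν.real (Iic (quantile ν lam)) := by
  set S : Set ℝ := {t : ℝ | ν.real (Iic t) ≤ lam * ν.real univ} with hS
  have hx : quantile ν lam = sSup S := rfl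
  have hmono : ∀ s t : ℝ, s ≤ t → ν.real (Iic s) ≤ ν.real (Iic t) := fun s t hst =>
    measureReal_mono (Iic_subset_Iic.2 hst)
  have hne : S.Nonempty := by
    have hI : ⋂ t : ℝ, Iic t = ∅ := iInter_Iic_eq_empty_iff.2 (by simp [not_bddBelow_univ])
    have ht := tendsto_measure_iInter_atBot (μ := ν) (s := fun t : ℝ => Iic t)
      (fun t => measurableSet_Iic.nullMeasurableSet)
      (fun s t hst => Iic_subset_Iic.2 hst) ⟨0, measure_ne_top _ _⟩
    replace ht := (ENNReal.tendsto_toReal (measure_ne_top ν _)).comp ht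
    rw [hI, measure_empty, ENNReal.toReal_zero] at ht
    exact ((ht.eventually (gt_mem_nhds (mul_pos h0 hN))).mono fun t ht => ht.le).exists
  have hbdd : BddAbove S := by
    have ht := (ENNReal.tendsto_toReal (measure_ne_top ν univ)).comp (tendsto_measure_Iic_atTop ν)
    have hlt : lam * ν.real univ < (ν univ).toReal := by
      change _ < ν.real univ
      nlinarith
    obtain ⟨b, hb⟩ := (ht.eventually (lt_mem_nhds hlt)).exists
    refine ⟨b, fun t ht => ?_⟩
    by_contra hcon
    have := hmono b t (not_le.1 hcon).le
    have h2 : ν.real (Iic t) ≤ lam * ν.real univ := ht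
    have h3 : lam * ν.real univ < ν.real (Iic b) := hb
    linarith
  rw [hx]
  constructor
  · obtain ⟨u, hu, hlt, hlim⟩ := exists_seq_strictMono_tendsto (sSup S)
    have hU : ⋃ n, Iic (u n) = Iio (sSup S) :=
      iUnion_Iic_eq_Iio_of_lt_of_tendsto hlt hlim
    have ht := tendsto_measure_iUnion_atTop (μ := ν)
      (s := fun n => Iic (u n)) (fun m n hmn => Iic_subset_Iic.2 (hu.monotone hmn))
    rw [hU] at ht
    refine le_of_tendsto' ((ENNReal.tendsto_toReal (measure_ne_top ν _)).comp ht) fun n => ?_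
    obtain ⟨s, hs, hns⟩ := exists_lt_of_lt_csSup hne (hlt n)
    exact (hmono _ _ hns.le).trans hs
  · obtain ⟨u, hu, hlt, hlim⟩ := exists_seq_strictAnti_tendsto (sSup S)
    have hI : ⋂ n, Iic (u n) = Iic (sSup S) := by
      ext t
      simp only [mem_iInter, mem_Iic]
      exact ⟨fun h => ge_of_tendsto' hlim h, fun h n => h.trans (hlt n).le⟩
    have ht := tendsto_measure_iInter_atTop (μ := ν) (s := fun n => Iic (u n))
      (fun n => measurableSet_Iic.nullMeasurableSet)
      (fun m n hmn => Iic_subset_Iic.2 (hu.antitone hmn)) ⟨0, measure_ne_top _ _⟩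
    rw [hI] at ht
    refine ge_of_tendsto' ((ENNReal.tendsto_toReal (measure_ne_top ν _)).comp ht) fun n => ?_
    by_contra hcon
    exact (not_le.2 (hlt n)) (le_csSup hbdd (not_le.1 hcon).le)

/-- If an interval carries all but a small part of the mass, it contains the quantiles. -/
theorem quantile_mem_Icc (ν : Measure ℝ) [IsFiniteMeasure ν] {q a b : ℝ}
    (hq0 : 0 < q) (hν : ν.real (Icc a b)ᶜ < (1/2 - q) * ν.real univ) :
    a ≤ quantile ν (1/2 - q) ∧ quantile ν (1/2 - q) ≤ quantile ν (1/2 + q) ∧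
      quantile ν (1/2 + q) ≤ b := by
  have hN : 0 ≤ ν.real univ := measureReal_nonneg
  have hbS : ∀ t, ν.real (Iic t) ≤ (1/2 + q) * ν.real univ → t ≤ b := by
    intro t ht
    by_contra hcon
    have h1 : ν.real (Iic t) + ν.real (Iic t)ᶜ = ν.real univ :=
      measureReal_add_measureReal_compl measurableSet_Iic
    have h2 : ν.real (Iic t)ᶜ ≤ ν.real (Icc a b)ᶜ := by
      refine measureReal_mono fun s hs hs' => hs ?_
      exact hs'.2.trans (not_le.1 hcon).le
    linarith
  have haS : ∀ t, t < a → ν.real (Iic t) ≤ (1/2 - q) * ν.real univ := by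
    intro t ht
    refine le_trans (measureReal_mono (s₂ := (Icc a b)ᶜ) fun s (hs : s ≤ t) hs' => ?_) hν.le
    exact absurd (hs'.1.trans hs) (not_le.2 ht)
  have hsub : {t : ℝ | (ν (Iic t)).toReal ≤ (1/2 - q) * (ν univ).toReal} ⊆
      {t : ℝ | (ν (Iic t)).toReal ≤ (1/2 + q) * (ν univ).toReal} := by
    intro t ht
    refine le_trans (show _ ≤ _ from ht) (mul_le_mul_of_nonneg_right (by linarith) hN)
  have hbdd : BddAbove {t : ℝ | (ν (Iic t)).toReal ≤ (1/2 + q) * (ν univ).toReal} := ⟨b, hbS⟩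
  have hne : {t : ℝ | (ν (Iic t)).toReal ≤ (1/2 - q) * (ν univ).toReal}.Nonempty :=
    ⟨a - 1, haS _ (by linarith)⟩
  refine ⟨?_, csSup_le_csSup hbdd hne hsub, csSup_le (hne.mono hsub) hbS⟩
  refine le_of_forall_lt_imp_le_of_dense fun t ht => ?_
  exact le_csSup (hbdd.mono hsub) (haS t ht)

theorem measureReal_quantile_window_pos (ν : Measure ℝ) [IsFiniteMeasure ν] {q : ℝ}
    (hN : 0 < ν.real univ) (hq0 : 0 < q) (hq : q < 1/2) :
    2 * q * ν.real univ ≤ ν.real (Icc (quantile ν (1/2 - q)) (quantile ν (1/2 + q))) := by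
  have h1 := (quantile_spec ν hN (lam := 1/2 - q) (by linarith) (by linarith)).1
  have h2 := (quantile_spec ν hN (lam := 1/2 + q) (by linarith) (by linarith)).2
  have h3 : ν.real (Iic (quantile ν (1/2 + q))) ≤
      ν.real (Iio (quantile ν (1/2 - q))) +
        ν.real (Icc (quantile ν (1/2 - q)) (quantile ν (1/2 + q))) := by
    refine le_trans (measureReal_mono fun t ht => ?_) (measureReal_union_le _ _)
    rcases lt_or_ge t (quantile ν (1/2 - q)) with h | h
    · exact Or.inl h
    · exact Or.inr ⟨h, ht⟩
  linarith

/-- The regularized median lies in the quantile window. -/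
theorem medComp_mem_Icc (ν : Measure ℝ) [IsFiniteMeasure ν] {q a b : ℝ}
    (hq0 : 0 < q) (hq : q < 1/2) (hν : ν.real (Icc a b)ᶜ < (1/2 - q) * ν.real univ) :
    medComp q ν ∈ Icc a b := by
  have hN : 0 < ν.real univ := by
    have : 0 ≤ ν.real (Icc a b)ᶜ := measureReal_nonneg
    exact pos_of_mul_pos_right (this.trans_lt hν) (by linarith)
  obtain ⟨ha, -, hb⟩ := quantile_mem_Icc ν hq0 hν
  have hK := measureReal_quantile_window_pos ν hN hq0 hq
  set K := Icc (quantile ν (1/2 - q)) (quantile ν (1/2 + q)) with hKdef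
  have hKpos : 0 < ν.real K := lt_of_lt_of_le (by positivity) hK
  have hint : IntegrableOn (fun t : ℝ => t) K ν :=
    continuous_id.continuousOn.integrableOn_compact isCompact_Icc
  have hc : ∀ c : ℝ, ∫ _ in K, c ∂ν = c * ν.real K := fun c => by
    rw [setIntegral_const, smul_eq_mul, mul_comm]
  change (∫ t in K, t ∂ν) / ν.real K ∈ _
  constructor
  · rw [le_div_iff₀ hKpos, ← hc]
    exact setIntegral_mono_on (integrableOn_const (measure_ne_top _ _)) hint measurableSet_Icc
      fun t ht => ha.trans ht.1
  · rw [div_le_iff₀ hKpos, ← hc]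
    exact setIntegral_mono_on hint (integrableOn_const (measure_ne_top _ _)) measurableSet_Icc
      fun t ht => ht.2.trans hb

/-- Integration by parts against the distribution function. -/
theorem setIntegral_id_eq_sub_integral_Iic (ν : Measure ℝ) [IsFiniteMeasure ν] [NullSingletonClass ν]
    {a b : ℝ} (hab : a ≤ b) :
    ∫ t in Icc a b, t ∂ν =
      b * ν.real (Iic b) - a * ν.real (Iic a) - ∫ t in a..b, ν.real (Iic t) := by
  have hmeas : ∀ s t : ℝ, s ≤ t → ν.real (Ioc s t) = ν.real (Iic t) - ν.real (Iic s) := by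
    intro s t hst
    have : Ioc s t = Iic t \ Iic s := by
      ext; simp [and_comm]
    rw [this, measureReal_sdiff (Iic_subset_Iic.2 hst) measurableSet_Iic]
  have hF : IntervalIntegrable (fun t => ν.real (Iic t)) volume a b :=
    Monotone.intervalIntegrable fun s t hst => measureReal_mono (Iic_subset_Iic.2 hst)
  have hset : MeasurableSet {p : ℝ × ℝ | p.1 ≤ p.2} := measurableSet_le measurable_fst measurable_snd
  have hswap := integral_integral_swap (μ := ν.restrict (Ioc a b))
    (ν := volume.restrict (Ioc a b))
    (f := fun t s => {p : ℝ × ℝ | p.1 ≤ p.2}.indicator (fun _ => (1:ℝ)) (t, s))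
    ((integrable_const (1:ℝ)).indicator hset)
  have h1 : ∀ t ∈ Ioc a b, ∫ s in Ioc a b,
      {p : ℝ × ℝ | p.1 ≤ p.2}.indicator (fun _ => (1:ℝ)) (t, s) = b - t := by
    intro t ht
    have : (fun s : ℝ => {p : ℝ × ℝ | p.1 ≤ p.2}.indicator (fun _ => (1:ℝ)) (t, s)) =
        (Ici t).indicator (fun _ => 1) := by
      ext s; simp [indicator, mem_Ici]
    rw [this, setIntegral_indicator measurableSet_Ici, setIntegral_const, smul_eq_mul, mul_one]
    have : Ioc a b ∩ Ici t = Icc t b := by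
      ext s; simp only [mem_inter_iff, mem_Ioc, mem_Ici, mem_Icc]
      exact ⟨fun h => ⟨h.2, h.1.2⟩, fun h => ⟨⟨lt_of_lt_of_le ht.1 h.1, h.2⟩, h.1⟩⟩
    rw [this, Real.volume_real_Icc_of_le ht.2]
  have h2 : ∀ s ∈ Ioc a b, ∫ t in Ioc a b,
      {p : ℝ × ℝ | p.1 ≤ p.2}.indicator (fun _ => (1:ℝ)) (t, s) ∂ν =
        ν.real (Iic s) - ν.real (Iic a) := by
    intro s hs
    have : (fun t : ℝ => {p : ℝ × ℝ | p.1 ≤ p.2}.indicator (fun _ => (1:ℝ)) (t, s)) =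
        (Iic s).indicator (fun _ => 1) := by
      ext t; simp [indicator, mem_Iic]
    rw [this, setIntegral_indicator measurableSet_Iic, setIntegral_const, smul_eq_mul, mul_one,
      Ioc_inter_Iic, min_eq_right hs.2, hmeas _ _ hs.1.le]
  have hid : IntegrableOn (fun t : ℝ => t) (Ioc a b) ν :=
    (continuous_id.continuousOn.integrableOn_Icc).mono_set Ioc_subset_Icc_self
  rw [setIntegral_congr_fun measurableSet_Ioc h1, setIntegral_congr_fun measurableSet_Ioc h2,
    ← intervalIntegral.integral_of_le (μ := volume) hab, intervalIntegral.integral_sub hF (by simp),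
    intervalIntegral.integral_const, integral_sub (integrable_const _) hid,
    setIntegral_const, hmeas _ _ hab] at hswap
  rw [integral_Icc_eq_integral_Ioc]
  simp only [smul_eq_mul] at hswap
  linarith

theorem measureReal_Iic_quantile (ν : Measure ℝ) [IsFiniteMeasure ν] [NullSingletonClass ν]
    (hN : 0 < ν.real univ) {lam : ℝ} (h0 : 0 < lam) (h1 : lam < 1) :
    ν.real (Iic (quantile ν lam)) = lam * ν.real univ := by
  obtain ⟨h2, h3⟩ := quantile_spec ν hN h0 h1
  have : ν.real (Iio (quantile ν lam)) = ν.real (Iic (quantile ν lam)) :=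
    measureReal_congr Iio_ae_eq_Iic
  linarith

theorem measureReal_Iic_mono (ν : Measure ℝ) [IsFiniteMeasure ν] :
    Monotone fun t : ℝ => ν.real (Iic t) :=
  fun _ _ h => measureReal_mono (Iic_subset_Iic.2 h)

/-- The distribution function of `ν`, truncated at the levels `1/2 ± q`. -/
def clampCdf (q : ℝ) (ν : Measure ℝ) (t : ℝ) : ℝ :=
  max ((1/2 - q) * ν.real univ) (min (ν.real (Iic t)) ((1/2 + q) * ν.real univ))

theorem clampCdf_monotone (q : ℝ) (ν : Measure ℝ) [IsFiniteMeasure ν] :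
    Monotone (clampCdf q ν) := fun _ _ h =>
  max_le_max le_rfl (min_le_min (measureReal_Iic_mono ν h) le_rfl)

theorem clampCdf_nonneg (q : ℝ) (hq : q < 1/2) (ν : Measure ℝ) (t : ℝ) : 0 ≤ clampCdf q ν t :=
  le_max_of_le_left (mul_nonneg (by linarith) measureReal_nonneg)

theorem clampCdf_le (q : ℝ) (hq0 : 0 < q) (ν : Measure ℝ) [IsFiniteMeasure ν] (t : ℝ) :
    clampCdf q ν t ≤ ν.real univ := by
  refine max_le ?_ ((min_le_left _ _).trans (measureReal_mono (subset_univ _)))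
  have : 0 ≤ ν.real univ := measureReal_nonneg
  nlinarith

theorem abs_mul_sub_mul_le {lam N N' a : ℝ} (h0 : 0 ≤ lam) (h1 : lam ≤ 1) (h : |N' - N| ≤ a) :
    |lam * N' - lam * N| ≤ a := by
  rw [← mul_sub, abs_mul, abs_of_nonneg h0]
  nlinarith [abs_nonneg (N' - N)]

theorem abs_clampCdf_sub_le {q a : ℝ} (hq0 : 0 < q) (hq : q < 1/2) {ν ν' : Measure ℝ} {t : ℝ}
    (hF : |ν'.real (Iic t) - ν.real (Iic t)| ≤ a) (hN : |ν'.real univ - ν.real univ| ≤ a) :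
    |clampCdf q ν' t - clampCdf q ν t| ≤ a := by
  refine (abs_max_sub_max_le_max _ _ _ _).trans (max_le ?_ ?_)
  · exact abs_mul_sub_mul_le (by linarith) (by linarith) hN
  · refine (abs_min_sub_min_le_max _ _ _ _).trans (max_le hF ?_)
    exact abs_mul_sub_mul_le (by linarith) (by linarith) hN

/-- The regularized median as an integral of the truncated distribution function. -/
theorem medComp_eq_integral_clampCdf (ν : Measure ℝ) [IsFiniteMeasure ν] [NullSingletonClass ν]
    {q A B : ℝ} (hq0 : 0 < q) (hq : q < 1/2) (hν : ν.real (Icc A B)ᶜ < (1/2 - q) * ν.real univ) :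
    2 * q * ν.real univ * medComp q ν =
      (B * (1/2 + q) - A * (1/2 - q)) * ν.real univ - ∫ t in A..B, clampCdf q ν t := by
  have hN : 0 < ν.real univ :=
    pos_of_mul_pos_right (measureReal_nonneg.trans_lt hν) (by linarith)
  obtain ⟨hA, hx, hB⟩ := quantile_mem_Icc ν hq0 hν
  have hm : (1/2 - q) * ν.real univ ≤ (1/2 + q) * ν.real univ := by nlinarith
  have hFm := measureReal_Iic_quantile ν hN (lam := 1/2 - q) (by linarith) (by linarith)
  have hFp := measureReal_Iic_quantile ν hN (lam := 1/2 + q) (by linarith) (by linarith)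
  have hI : ∀ s t : ℝ, IntervalIntegrable (clampCdf q ν) volume s t := fun s t =>
    (clampCdf_monotone q ν).intervalIntegrable
  have hK : ν.real (Icc (quantile ν (1/2 - q)) (quantile ν (1/2 + q))) = 2 * q * ν.real univ := by
    have h1 : Icc (quantile ν (1/2 - q)) (quantile ν (1/2 + q)) =
        Iic (quantile ν (1/2 + q)) \ Iio (quantile ν (1/2 - q)) := by
      ext; simp [and_comm]
    have h2 : ν.real (Iio (quantile ν (1/2 - q))) = ν.real (Iic (quantile ν (1/2 - q))) :=
      measureReal_congr Iio_ae_eq_Iic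
    rw [h1, measureReal_sdiff (Iio_subset_Iic hx) measurableSet_Iio, h2, hFm, hFp]
    ring
  have hmed : 2 * q * ν.real univ * medComp q ν =
      ∫ t in Icc (quantile ν (1/2 - q)) (quantile ν (1/2 + q)), t ∂ν := by
    change 2 * q * ν.real univ *
      (_ / ν.real (Icc (quantile ν (1/2 - q)) (quantile ν (1/2 + q)))) = _
    rw [hK]
    field_simp
  rw [hmed, setIntegral_id_eq_sub_integral_Iic ν hx, hFm, hFp,
    ← intervalIntegral.integral_add_adjacent_intervals (hI A _) (hI (quantile ν (1/2 + q)) B),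
    ← intervalIntegral.integral_add_adjacent_intervals (hI A (quantile ν (1/2 - q))) (hI _ _)]
  have e1 : ∫ t in A..quantile ν (1/2 - q), clampCdf q ν t =
      (quantile ν (1/2 - q) - A) * ((1/2 - q) * ν.real univ) := by
    rw [← smul_eq_mul, ← intervalIntegral.integral_const]
    refine intervalIntegral.integral_congr fun t ht => ?_
    rw [uIcc_of_le hA] at ht
    exact max_eq_left ((min_le_left _ _).trans ((measureReal_Iic_mono ν ht.2).trans hFm.le))
  have e2 : ∫ t in (quantile ν (1/2 - q))..quantile ν (1/2 + q), clampCdf q ν t =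
      ∫ t in (quantile ν (1/2 - q))..quantile ν (1/2 + q), ν.real (Iic t) := by
    refine intervalIntegral.integral_congr fun t ht => ?_
    rw [uIcc_of_le hx] at ht
    have h1 := measureReal_Iic_mono ν ht.1
    have h2 := measureReal_Iic_mono ν ht.2
    simp only [hFm, hFp] at h1 h2
    simp only [clampCdf]
    rw [min_eq_left h2, max_eq_right h1]
  have e3 : ∫ t in (quantile ν (1/2 + q))..B, clampCdf q ν t =
      (B - quantile ν (1/2 + q)) * ((1/2 + q) * ν.real univ) := by
    rw [← smul_eq_mul, ← intervalIntegral.integral_const]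
    refine intervalIntegral.integral_congr fun t ht => ?_
    rw [uIcc_of_le hB] at ht
    have h1 := measureReal_Iic_mono ν ht.1
    simp only [hFp] at h1
    simp only [clampCdf]
    rw [min_eq_right h1, max_eq_right hm]
  rw [e1, e2, e3]
  ring

/-- Lipschitz dependence of the regularized median on the distribution function. -/
theorem abs_medComp_sub_le (ν ν' : Measure ℝ) [IsFiniteMeasure ν] [NullSingletonClass ν]
    [IsFiniteMeasure ν'] [NullSingletonClass ν'] {q A B a d : ℝ} (hd : 0 < d)
    (hq0 : 0 < q) (hq : q < 1/2) (hAB : A ≤ B) (hdν : d ≤ ν.real univ) (hdν' : d ≤ ν'.real univ)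
    (hν : ν.real (Icc A B)ᶜ < (1/2 - q) * ν.real univ)
    (hν' : ν'.real (Icc A B)ᶜ < (1/2 - q) * ν'.real univ)
    (hF : ∀ t, |ν'.real (Iic t) - ν.real (Iic t)| ≤ a) (hN : |ν'.real univ - ν.real univ| ≤ a) :
    |medComp q ν' - medComp q ν| ≤ (B - A) * a / (q * d) := by
  have e := medComp_eq_integral_clampCdf ν hq0 hq hν
  have e' := medComp_eq_integral_clampCdf ν' hq0 hq hν'
  have hI : IntervalIntegrable (clampCdf q ν) volume A B :=
    (clampCdf_monotone q ν).intervalIntegrable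
  have hI' : IntervalIntegrable (clampCdf q ν') volume A B :=
    (clampCdf_monotone q ν').intervalIntegrable
  have hcl : ∀ t, |clampCdf q ν' t - clampCdf q ν t| ≤ a := fun t =>
    abs_clampCdf_sub_le hq0 hq (hF t) hN
  have hcl0 : ∀ t, 0 ≤ clampCdf q ν' t := clampCdf_nonneg q hq ν'
  have hcl1 : ∀ t, clampCdf q ν' t ≤ ν'.real univ := clampCdf_le q hq0 ν'
  set N := ν.real univ
  set N' := ν'.real univ
  have hNpos : 0 < N := hd.trans_le hdν
  have hNpos' : 0 < N' := hd.trans_le hdν'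
  have ha : 0 ≤ a := (abs_nonneg _).trans hN
  have key : 2 * q * (medComp q ν' - medComp q ν) =
      ∫ t in A..B, (N⁻¹ * clampCdf q ν t - N'⁻¹ * clampCdf q ν' t) := by
    rw [intervalIntegral.integral_sub (hI.const_mul _) (hI'.const_mul _),
      intervalIntegral.integral_const_mul, intervalIntegral.integral_const_mul]
    have h1 : ∫ t in A..B, clampCdf q ν t =
        N * (B * (1/2 + q) - A * (1/2 - q) - 2 * q * medComp q ν) := by linarith
    have h2 : ∫ t in A..B, clampCdf q ν' t =
        N' * (B * (1/2 + q) - A * (1/2 - q) - 2 * q * medComp q ν') := by linarith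
    rw [h1, h2, inv_mul_cancel_left₀ hNpos.ne', inv_mul_cancel_left₀ hNpos'.ne']
    ring
  have hb : ‖∫ t in A..B, (N⁻¹ * clampCdf q ν t - N'⁻¹ * clampCdf q ν' t)‖ ≤
      2 * a / d * |B - A| := by
    refine intervalIntegral.norm_integral_le_of_norm_le_const fun t _ => ?_
    have h1 : N⁻¹ * clampCdf q ν t - N'⁻¹ * clampCdf q ν' t =
        N⁻¹ * ((clampCdf q ν t - clampCdf q ν' t) + (N'⁻¹ * clampCdf q ν' t) * (N' - N)) := by
      field_simp
      ring
    have h2 : |N'⁻¹ * clampCdf q ν' t| ≤ 1 := by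
      rw [abs_of_nonneg (mul_nonneg (inv_nonneg.2 hNpos'.le) (hcl0 t)), inv_mul_le_iff₀ hNpos',
        mul_one]
      exact hcl1 t
    have h3 : |(clampCdf q ν t - clampCdf q ν' t) + (N'⁻¹ * clampCdf q ν' t) * (N' - N)| ≤
        a + a := by
      refine (abs_add_le _ _).trans (add_le_add ?_ ?_)
      · rw [abs_sub_comm]; exact hcl t
      · rw [abs_mul]
        nlinarith [abs_nonneg (N' - N), abs_nonneg (N'⁻¹ * clampCdf q ν' t)]
    rw [h1, Real.norm_eq_abs, abs_mul, abs_of_pos (inv_pos.2 hNpos), mul_comm, ← div_eq_mul_inv]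
    calc _ ≤ (a + a) / d := by gcongr
      _ = 2 * a / d := by ring
  rw [← key, Real.norm_eq_abs, abs_mul, abs_of_pos (by positivity : 0 < 2 * q),
    abs_of_nonneg (sub_nonneg.2 hAB)] at hb
  rw [le_div_iff₀ (by positivity)]
  have h4 : 2 * a / d * (B - A) = 2 * (((B - A) * a) / d) := by ring
  rw [h4, ← sub_nonneg] at hb
  have h5 : |medComp q ν' - medComp q ν| * q ≤ (B - A) * a / d := by linarith
  rw [le_div_iff₀ hd] at h5
  linarith

/-- First variation of `2q ν(ℝ) (m_q(ν) - m_q(ν₀))` around `ν₀`, as a functional linear in `ν`. -/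
def medLin (q : ℝ) (ν₀ ν : Measure ℝ) : ℝ :=
  (∫ t in Icc (quantile ν₀ (1/2 - q)) (quantile ν₀ (1/2 + q)), (t - medComp q ν₀) ∂ν)
    + (quantile ν₀ (1/2 + q) - medComp q ν₀)
        * ((1/2 + q) * ν.real univ - ν.real (Iic (quantile ν₀ (1/2 + q))))
    + (medComp q ν₀ - quantile ν₀ (1/2 - q))
        * ((1/2 - q) * ν.real univ - ν.real (Iic (quantile ν₀ (1/2 - q))))

/-- The error made by the first variation `medLin`. -/
def medRem (q : ℝ) (ν₀ : Measure ℝ) (A B : ℝ) (ν : Measure ℝ) : ℝ :=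
  (∫ t in A..quantile ν₀ (1/2 - q), ((1/2 - q) * ν.real univ - clampCdf q ν t))
    + (∫ t in quantile ν₀ (1/2 - q)..quantile ν₀ (1/2 + q), (ν.real (Iic t) - clampCdf q ν t))
    + ∫ t in quantile ν₀ (1/2 + q)..B, ((1/2 + q) * ν.real univ - clampCdf q ν t)

theorem medComp_eq_medLin_add_medRem (ν₀ ν : Measure ℝ) [IsFiniteMeasure ν]
    [NullSingletonClass ν] {q A B : ℝ} (hq0 : 0 < q) (hq : q < 1/2)
    (hν : ν.real (Icc A B)ᶜ < (1/2 - q) * ν.real univ)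
    (hx : quantile ν₀ (1/2 - q) ≤ quantile ν₀ (1/2 + q)) :
    2 * q * ν.real univ * (medComp q ν - medComp q ν₀) =
      medLin q ν₀ ν + medRem q ν₀ A B ν := by
  have hI : ∀ s t : ℝ, IntervalIntegrable (clampCdf q ν) volume s t := fun s t =>
    (clampCdf_monotone q ν).intervalIntegrable
  have hF : ∀ s t : ℝ, IntervalIntegrable (fun t => ν.real (Iic t)) volume s t := fun s t =>
    (measureReal_Iic_mono ν).intervalIntegrable
  have hc : ∀ c s t : ℝ, IntervalIntegrable (fun _ => c) volume s t := fun c s t => by simp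
  have hK : ν.real (Icc (quantile ν₀ (1/2 - q)) (quantile ν₀ (1/2 + q))) =
      ν.real (Iic (quantile ν₀ (1/2 + q))) - ν.real (Iic (quantile ν₀ (1/2 - q))) := by
    have h1 : Icc (quantile ν₀ (1/2 - q)) (quantile ν₀ (1/2 + q)) =
        Iic (quantile ν₀ (1/2 + q)) \ Iio (quantile ν₀ (1/2 - q)) := by
      ext; simp [and_comm]
    have h2 : ν.real (Iio (quantile ν₀ (1/2 - q))) = ν.real (Iic (quantile ν₀ (1/2 - q))) :=
      measureReal_congr Iio_ae_eq_Iic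
    rw [h1, measureReal_sdiff (Iio_subset_Iic hx) measurableSet_Iio, h2]
  rw [mul_sub, medComp_eq_integral_clampCdf ν hq0 hq hν,
    ← intervalIntegral.integral_add_adjacent_intervals (hI A _)
      (hI (quantile ν₀ (1/2 + q)) B),
    ← intervalIntegral.integral_add_adjacent_intervals (hI A (quantile ν₀ (1/2 - q))) (hI _ _),
    medLin, medRem, intervalIntegral.integral_sub (hc _ _ _) (hI _ _),
    intervalIntegral.integral_sub (hc _ _ _) (hI _ _),
    intervalIntegral.integral_sub (hF _ _) (hI _ _), integral_sub
      (continuous_id'.continuousOn.integrableOn_Icc) (integrable_const _),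
    setIntegral_const, hK, setIntegral_id_eq_sub_integral_Iic ν hx,
    intervalIntegral.integral_const, intervalIntegral.integral_const]
  simp only [smul_eq_mul]
  ring

theorem integral_indicator_Icc_le (A B p τ : ℝ) (hτ : 0 ≤ τ) (hAB : A ≤ B) :
    ∫ t in A..B, (Icc (p - τ) (p + τ)).indicator (fun _ => (1:ℝ)) t ≤ 2 * τ := by
  rw [intervalIntegral.integral_of_le hAB]
  calc _ ≤ ∫ t, (Icc (p - τ) (p + τ)).indicator (fun _ => (1:ℝ)) t := by
        refine setIntegral_le_integral ?_ (.of_forall fun t => ?_)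
        · exact (integrable_indicator_iff measurableSet_Icc).2 (integrableOn_const (by simp))
        · exact indicator_nonneg (fun _ _ => zero_le_one) _
    _ = 2 * τ := by
        rw [integral_indicator measurableSet_Icc, setIntegral_const, smul_eq_mul, mul_one,
          Real.volume_real_Icc_of_le (by linarith)]
        ring

/-- Two functions that differ only near two points have nearby integrals. -/
theorem abs_integral_sub_integral_le {u v : ℝ → ℝ} {A B p p' τ M : ℝ} (hAB : A ≤ B)
    (hτ : 0 ≤ τ) (hM : 0 ≤ M)
    (hu : IntervalIntegrable u volume A B) (hv : IntervalIntegrable v volume A B)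
    (hle : ∀ t, |u t - v t| ≤ M)
    (hne : ∀ t ∈ Icc A B, u t ≠ v t → |t - p| ≤ τ ∨ |t - p'| ≤ τ) :
    |(∫ t in A..B, u t) - ∫ t in A..B, v t| ≤ M * (4 * τ) := by
  have hi : ∀ p : ℝ, IntervalIntegrable
      ((Icc (p - τ) (p + τ)).indicator (fun _ => (1:ℝ))) volume A B := fun p =>
    (((integrable_indicator_iff measurableSet_Icc).2
      (integrableOn_const (by simp))).intervalIntegrable)
  rw [← intervalIntegral.integral_sub hu hv, ← Real.norm_eq_abs]
  have hmem : ∀ t p : ℝ, |t - p| ≤ τ → t ∈ Icc (p - τ) (p + τ) := fun t p h => by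
    rw [abs_le] at h
    exact ⟨by linarith, by linarith⟩
  have hnn : ∀ t p : ℝ, 0 ≤ (Icc (p - τ) (p + τ)).indicator (fun _ => (1:ℝ)) t := fun t p =>
    indicator_nonneg (fun _ _ => zero_le_one) _
  have hb : ‖∫ t in A..B, (u t - v t)‖ ≤ ∫ t in A..B,
      M * ((Icc (p - τ) (p + τ)).indicator (fun _ => (1:ℝ)) t +
        (Icc (p' - τ) (p' + τ)).indicator (fun _ => (1:ℝ)) t) := by
    refine intervalIntegral.norm_integral_le_of_norm_le hAB (.of_forall fun t ht => ?_)
      (((hi p).add (hi p')).const_mul M)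
    by_cases h : u t = v t
    · rw [h, sub_self, norm_zero]
      exact mul_nonneg hM (add_nonneg (hnn _ _) (hnn _ _))
    · refine (hle t).trans (le_mul_of_one_le_right hM ?_)
      rcases hne t (Ioc_subset_Icc_self ht) h with h | h
      · rw [indicator_of_mem (hmem t p h)]
        linarith [hnn t p']
      · rw [indicator_of_mem (hmem t p' h)]
        linarith [hnn t p]
  refine hb.trans ?_
  rw [intervalIntegral.integral_const_mul, intervalIntegral.integral_add (hi _) (hi _)]
  refine mul_le_mul_of_nonneg_left ?_ hM
  linarith [integral_indicator_Icc_le A B p τ hτ hAB, integral_indicator_Icc_le A B p' τ hτ hAB]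

/-- Distance of the distribution function of `ν₀` to its levels `1/2 ± q`, at points where the
error density of the first variation does not vanish. -/
theorem abs_cdf_sub_level_le {F₀ F N₀ N q b : ℝ} (hF : |F - F₀| ≤ b) (hN : |N - N₀| ≤ b)
    (hq0 : 0 < q) (hq : q < 1/2) :
    (F₀ ≤ (1/2 - q) * N₀ → (1/2 - q) * N < F → |F₀ - (1/2 - q) * N₀| ≤ 2 * b) ∧
    ((1/2 - q) * N₀ ≤ F₀ → F < (1/2 - q) * N → |F₀ - (1/2 - q) * N₀| ≤ 2 * b) ∧
    (F₀ ≤ (1/2 + q) * N₀ → (1/2 + q) * N < F → |F₀ - (1/2 + q) * N₀| ≤ 2 * b) ∧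
    ((1/2 + q) * N₀ ≤ F₀ → F < (1/2 + q) * N → |F₀ - (1/2 + q) * N₀| ≤ 2 * b) := by
  have h1 := abs_le.1 (abs_mul_sub_mul_le (lam := 1/2 - q) (by linarith) (by linarith) hN)
  have h2 := abs_le.1 (abs_mul_sub_mul_le (lam := 1/2 + q) (by linarith) (by linarith) hN)
  have h3 := abs_le.1 hF
  refine ⟨fun h h' => ?_, fun h h' => ?_, fun h h' => ?_, fun h h' => ?_⟩ <;>
    rw [abs_le] <;> constructor <;> linarith

theorem clampCdf_eq_left {q : ℝ} {ν : Measure ℝ} {t : ℝ}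
    (h : ν.real (Iic t) ≤ (1/2 - q) * ν.real univ) :
    clampCdf q ν t = (1/2 - q) * ν.real univ :=
  max_eq_left ((min_le_left _ _).trans h)

theorem clampCdf_eq_right {q : ℝ} {ν : Measure ℝ} {t : ℝ} (hq0 : 0 < q)
    (h : (1/2 + q) * ν.real univ ≤ ν.real (Iic t)) :
    clampCdf q ν t = (1/2 + q) * ν.real univ := by
  have : 0 ≤ ν.real univ := measureReal_nonneg
  rw [clampCdf, min_eq_right h, max_eq_right (by nlinarith)]

theorem clampCdf_eq_self {q : ℝ} {ν : Measure ℝ} {t : ℝ}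
    (h1 : (1/2 - q) * ν.real univ ≤ ν.real (Iic t))
    (h2 : ν.real (Iic t) ≤ (1/2 + q) * ν.real univ) :
    clampCdf q ν t = ν.real (Iic t) := by
  rw [clampCdf, min_eq_left h2, max_eq_right h1]

/-- Quadratic estimate for the error of the first variation. -/
theorem abs_medRem_sub_le (ν₀ ν ν' : Measure ℝ) [IsFiniteMeasure ν₀] [NullSingletonClass ν₀]
    [IsFiniteMeasure ν] [IsFiniteMeasure ν'] {q A B a b c : ℝ} (hq0 : 0 < q) (hq : q < 1/2)
    (hc : 0 < c) (hb : 0 ≤ b)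
    (hν₀ : ν₀.real (Icc A B)ᶜ < (1/2 - q) * ν₀.real univ)
    (hF : ∀ t, |ν'.real (Iic t) - ν.real (Iic t)| ≤ a) (hN : |ν'.real univ - ν.real univ| ≤ a)
    (hF₀ : ∀ t, |ν.real (Iic t) - ν₀.real (Iic t)| ≤ b) (hN₀ : |ν.real univ - ν₀.real univ| ≤ b)
    (hgm : ∀ t ∈ Icc A B, c * |t - quantile ν₀ (1/2 - q)| ≤
      |ν₀.real (Iic t) - ν₀.real (Iic (quantile ν₀ (1/2 - q)))|)
    (hgp : ∀ t ∈ Icc A B, c * |t - quantile ν₀ (1/2 + q)| ≤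
      |ν₀.real (Iic t) - ν₀.real (Iic (quantile ν₀ (1/2 + q)))|) :
    |medRem q ν₀ A B ν' - medRem q ν₀ A B ν| ≤ 48 * a * (a + b) / c := by
  have hN0 : 0 < ν₀.real univ :=
    pos_of_mul_pos_right (measureReal_nonneg.trans_lt hν₀) (by linarith)
  obtain ⟨hA, hx, hB⟩ := quantile_mem_Icc ν₀ hq0 hν₀
  have hFm := measureReal_Iic_quantile ν₀ hN0 (lam := 1/2 - q) (by linarith) (by linarith)
  have hFp := measureReal_Iic_quantile ν₀ hN0 (lam := 1/2 + q) (by linarith) (by linarith)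
  rw [hFm] at hgm
  rw [hFp] at hgp
  have ha : 0 ≤ a := (abs_nonneg _).trans hN
  set τ := 2 * (a + b) / c with hτdef
  have hτ : 0 ≤ τ := by positivity
  have hF1 : ∀ t, |ν.real (Iic t) - ν₀.real (Iic t)| ≤ a + b := fun t => by linarith [hF₀ t]
  have hN1 : |ν.real univ - ν₀.real univ| ≤ a + b := by linarith
  have hF2 : ∀ t, |ν'.real (Iic t) - ν₀.real (Iic t)| ≤ a + b := fun t =>
    (abs_sub_le _ (ν.real (Iic t)) _).trans (add_le_add (hF t) (hF₀ t))
  have hN2 : |ν'.real univ - ν₀.real univ| ≤ a + b :=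
    (abs_sub_le _ (ν.real univ) _).trans (add_le_add hN hN₀)
  have nearm : ∀ t ∈ Icc A B, |ν₀.real (Iic t) - (1/2 - q) * ν₀.real univ| ≤ 2 * (a + b) →
      |t - quantile ν₀ (1/2 - q)| ≤ τ ∨ |t - quantile ν₀ (1/2 + q)| ≤ τ := fun t ht h => by
    left
    rw [hτdef, le_div_iff₀ hc]
    linarith [hgm t ht]
  have nearp : ∀ t ∈ Icc A B, |ν₀.real (Iic t) - (1/2 + q) * ν₀.real univ| ≤ 2 * (a + b) →
      |t - quantile ν₀ (1/2 - q)| ≤ τ ∨ |t - quantile ν₀ (1/2 + q)| ≤ τ := fun t ht h => by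
    right
    rw [hτdef, le_div_iff₀ hc]
    linarith [hgp t ht]
  have hcl : ∀ t, |clampCdf q ν' t - clampCdf q ν t| ≤ a := fun t =>
    abs_clampCdf_sub_le hq0 hq (hF t) hN
  have hI : ∀ (μ : Measure ℝ) [IsFiniteMeasure μ] (s t : ℝ),
      IntervalIntegrable (clampCdf q μ) volume s t := fun μ _ s t =>
    (clampCdf_monotone q μ).intervalIntegrable
  have hFI : ∀ (μ : Measure ℝ) [IsFiniteMeasure μ] (s t : ℝ),
      IntervalIntegrable (fun t => μ.real (Iic t)) volume s t := fun μ _ s t =>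
    (measureReal_Iic_mono μ).intervalIntegrable
  have hcI : ∀ c s t : ℝ, IntervalIntegrable (fun _ => c) volume s t := fun c s t => by simp
  have htri : ∀ x y x' y' : ℝ, |x - y| ≤ a → |x' - y'| ≤ a → |(x - x') - (y - y')| ≤ 2 * a := by
    intro x y x' y' h h'
    rw [abs_le] at *
    constructor <;> linarith
  have hor : ∀ {x y : ℝ}, x ≠ y → x ≠ 0 ∨ y ≠ 0 := fun {x y} h => by
    by_contra! hh
    exact h (hh.1.trans hh.2.symm)
  have P1 := abs_integral_sub_integral_le (p := quantile ν₀ (1/2 - q))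
    (p' := quantile ν₀ (1/2 + q)) (M := 2 * a) hA hτ (by positivity)
    ((hcI ((1/2 - q) * ν'.real univ) _ _).sub (hI ν' _ _))
    ((hcI ((1/2 - q) * ν.real univ) _ _).sub (hI ν _ _))
    (fun t => htri _ _ _ _ (abs_mul_sub_mul_le (by linarith) (by linarith) hN) (hcl t))
    (by
      intro t ht hne
      have h0 := (measureReal_Iic_mono ν₀ ht.2).trans hFm.le
      refine nearm t ⟨ht.1, ht.2.trans (hx.trans hB)⟩ ?_
      rcases hor hne with h | h
      · refine (abs_cdf_sub_level_le (hF2 t) hN2 hq0 hq).1 h0 (lt_of_not_ge fun h' => h ?_)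
        rw [clampCdf_eq_left h', sub_self]
      · refine (abs_cdf_sub_level_le (hF1 t) hN1 hq0 hq).1 h0 (lt_of_not_ge fun h' => h ?_)
        rw [clampCdf_eq_left h', sub_self])
  have P2 := abs_integral_sub_integral_le (p := quantile ν₀ (1/2 - q))
    (p' := quantile ν₀ (1/2 + q)) (M := 2 * a) hx hτ (by positivity)
    ((hFI ν' _ _).sub (hI ν' _ _)) ((hFI ν _ _).sub (hI ν _ _))
    (fun t => htri _ _ _ _ (hF t) (hcl t))
    (by
      intro t ht hne
      have h0 := hFm.ge.trans (measureReal_Iic_mono ν₀ ht.1)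
      have h1 := (measureReal_Iic_mono ν₀ ht.2).trans hFp.le
      have htAB : t ∈ Icc A B := ⟨hA.trans ht.1, ht.2.trans hB⟩
      have gen : ∀ μ : Measure ℝ, (∀ t, |μ.real (Iic t) - ν₀.real (Iic t)| ≤ a + b) →
          |μ.real univ - ν₀.real univ| ≤ a + b → μ.real (Iic t) - clampCdf q μ t ≠ 0 →
          |t - quantile ν₀ (1/2 - q)| ≤ τ ∨ |t - quantile ν₀ (1/2 + q)| ≤ τ := by
        intro μ hμ hμN h
        rcases lt_or_ge (μ.real (Iic t)) ((1/2 - q) * μ.real univ) with h2 | h2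
        · exact nearm t htAB ((abs_cdf_sub_level_le (hμ t) hμN hq0 hq).2.1 h0 h2)
        · refine nearp t htAB ((abs_cdf_sub_level_le (hμ t) hμN hq0 hq).2.2.1 h1
            (lt_of_not_ge fun h' => h ?_))
          rw [clampCdf_eq_self h2 h', sub_self]
      rcases hor hne with h | h
      · exact gen ν' hF2 hN2 h
      · exact gen ν hF1 hN1 h)
  have P3 := abs_integral_sub_integral_le (p := quantile ν₀ (1/2 - q))
    (p' := quantile ν₀ (1/2 + q)) (M := 2 * a) hB hτ (by positivity)
    ((hcI ((1/2 + q) * ν'.real univ) _ _).sub (hI ν' _ _))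
    ((hcI ((1/2 + q) * ν.real univ) _ _).sub (hI ν _ _))
    (fun t => htri _ _ _ _ (abs_mul_sub_mul_le (by linarith) (by linarith) hN) (hcl t))
    (by
      intro t ht hne
      have h0 := hFp.ge.trans (measureReal_Iic_mono ν₀ ht.1)
      refine nearp t ⟨(hA.trans hx).trans ht.1, ht.2⟩ ?_
      rcases hor hne with h | h
      · refine (abs_cdf_sub_level_le (hF2 t) hN2 hq0 hq).2.2.2 h0 (lt_of_not_ge fun h' => h ?_)
        rw [clampCdf_eq_right hq0 h', sub_self]
      · refine (abs_cdf_sub_level_le (hF1 t) hN1 hq0 hq).2.2.2 h0 (lt_of_not_ge fun h' => h ?_)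
        rw [clampCdf_eq_right hq0 h', sub_self])
  have hsum : 48 * a * (a + b) / c = 3 * (2 * a * (4 * τ)) := by
    rw [hτdef]
    ring
  rw [hsum, medRem, medRem]
  rw [abs_le] at *
  constructor <;> linarith [P1.1, P1.2, P2.1, P2.2, P3.1, P3.2]

/-- Second-order accuracy of the first variation of the regularized median on the line. -/
theorem abs_medComp_add_medLin_sub_le (ν₀ ν ν' : Measure ℝ) [IsFiniteMeasure ν₀]
    [NullSingletonClass ν₀] [IsFiniteMeasure ν] [NullSingletonClass ν] [IsFiniteMeasure ν']
    [NullSingletonClass ν'] {q A B a b c d : ℝ} (hq0 : 0 < q) (hq : q < 1/2)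
    (hc : 0 < c) (hd : 0 < d) (hAB : A ≤ B)
    (hdν₀ : d ≤ ν₀.real univ) (hdν : d ≤ ν.real univ) (hdν' : d ≤ ν'.real univ)
    (hν₀ : ν₀.real (Icc A B)ᶜ < (1/2 - q) * ν₀.real univ)
    (hν : ν.real (Icc A B)ᶜ < (1/2 - q) * ν.real univ)
    (hν' : ν'.real (Icc A B)ᶜ < (1/2 - q) * ν'.real univ)
    (hF : ∀ t, |ν'.real (Iic t) - ν.real (Iic t)| ≤ a) (hN : |ν'.real univ - ν.real univ| ≤ a)
    (hF₀ : ∀ t, |ν.real (Iic t) - ν₀.real (Iic t)| ≤ b) (hN₀ : |ν.real univ - ν₀.real univ| ≤ b)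
    (hgm : ∀ t ∈ Icc A B, c * |t - quantile ν₀ (1/2 - q)| ≤
      |ν₀.real (Iic t) - ν₀.real (Iic (quantile ν₀ (1/2 - q)))|)
    (hgp : ∀ t ∈ Icc A B, c * |t - quantile ν₀ (1/2 + q)| ≤
      |ν₀.real (Iic t) - ν₀.real (Iic (quantile ν₀ (1/2 + q)))|) :
    |medComp q ν + (2 * q * ν₀.real univ)⁻¹ * (medLin q ν₀ ν' - medLin q ν₀ ν) - medComp q ν'| ≤
      (2 * (B - A) / (q * d) + 24 / (c * q)) / d * a * (a + b) := by
  have hx := (quantile_mem_Icc ν₀ hq0 hν₀).2.1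
  have e := medComp_eq_medLin_add_medRem ν₀ ν hq0 hq hν hx
  have e' := medComp_eq_medLin_add_medRem ν₀ ν' hq0 hq hν' hx
  have hb : 0 ≤ b := (abs_nonneg _).trans hN₀
  have ha : 0 ≤ a := (abs_nonneg _).trans hN
  have hE := abs_medRem_sub_le ν₀ ν ν' hq0 hq hc hb hν₀ hF hN hF₀ hN₀ hgm hgp
  have hm := abs_medComp_sub_le ν ν' hd hq0 hq hAB hdν hdν' hν hν' hF hN
  have hm0 := abs_medComp_sub_le ν₀ ν hd hq0 hq hAB hdν₀ hdν hν₀ hν hF₀ hN₀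
  have hN0 : 0 < ν₀.real univ := hd.trans_le hdν₀
  set N₀ := ν₀.real univ
  set N := ν.real univ
  set N' := ν'.real univ
  set m₀ := medComp q ν₀
  set m := medComp q ν
  set m' := medComp q ν'
  have hm1 : |m' - m₀| ≤ (B - A) * (a + b) / (q * d) := by
    calc _ ≤ |m' - m| + |m - m₀| := abs_sub_le _ _ _
      _ ≤ (B - A) * a / (q * d) + (B - A) * b / (q * d) := add_le_add hm hm0
      _ = _ := by ring
  have hBA : 0 ≤ B - A := sub_nonneg.2 hAB
  have key : m + (2 * q * N₀)⁻¹ * (medLin q ν₀ ν' - medLin q ν₀ ν) - m' =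
      ((N' - N) * (m' - m₀) + (N - N₀) * (m' - m)
        - (medRem q ν₀ A B ν' - medRem q ν₀ A B ν) / (2 * q)) / N₀ := by
    have h1 : medLin q ν₀ ν' - medLin q ν₀ ν = 2 * q * (N' * (m' - m₀) - N * (m - m₀))
      - (medRem q ν₀ A B ν' - medRem q ν₀ A B ν) := by linarith
    rw [h1]
    field_simp
    ring
  have b1 : |(N' - N) * (m' - m₀)| ≤ a * ((B - A) * (a + b) / (q * d)) := by
    rw [abs_mul]
    exact mul_le_mul hN hm1 (abs_nonneg _) ha
  have b2 : |(N - N₀) * (m' - m)| ≤ b * ((B - A) * a / (q * d)) := by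
    rw [abs_mul]
    exact mul_le_mul hN₀ hm (abs_nonneg _) hb
  have b2' : b * ((B - A) * a / (q * d)) ≤ a * ((B - A) * (a + b) / (q * d)) := by
    have : b * ((B - A) * a / (q * d)) = a * ((B - A) * b / (q * d)) := by ring
    rw [this]
    gcongr
    linarith
  have b3 : |(medRem q ν₀ A B ν' - medRem q ν₀ A B ν) / (2 * q)| ≤
      48 * a * (a + b) / c / (2 * q) := by
    rw [abs_div, abs_of_pos (by positivity : 0 < 2 * q)]
    gcongr
  rw [key, abs_div, abs_of_pos hN0]
  calc _ ≤ (a * ((B - A) * (a + b) / (q * d)) + a * ((B - A) * (a + b) / (q * d))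
        + 48 * a * (a + b) / c / (2 * q)) / d := by
        gcongr
        refine (abs_sub _ _).trans (add_le_add ((abs_add_le _ _).trans ?_) b3)
        exact add_le_add b1 (b2.trans b2')
    _ = _ := by
        field_simp
        ring

/-- Even continuous probability densities with compact support. -/
structure IsEvenKernel (η : E3 → ℝ) : Prop where
  continuous : Continuous η
  compactSupport : HasCompactSupport η
  nonneg : ∀ y, 0 ≤ η y
  integral_one : (∫ y, η y) = 1
  even : ∀ y, η (-y) = η y

theorem IsMollifier.isEvenKernel {g : E3 → ℝ} (hg : IsMollifier g) (hrot : RotInv g) :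
    IsEvenKernel g where
  continuous := hg.smooth.continuous
  compactSupport := hg.compactSupport
  nonneg y := (hg.mem_Icc y).1
  integral_one := hg.integral_one
  even y := hrot _ _ (norm_neg y)

namespace IsEvenKernel

variable {η : E3 → ℝ}

theorem integrable (hη : IsEvenKernel η) : Integrable η :=
  hη.continuous.integrable_of_hasCompactSupport hη.compactSupport

theorem integrable_prod (hη : IsEvenKernel η) (ρ : Measure E3) [IsFiniteMeasure ρ] {k : E3 → ℝ}
    (hk : Measurable k) {M : ℝ} (hM : ∀ x, |k x| ≤ M) :
    Integrable (fun p : E3 × E3 => η (p.2 - p.1) * k p.2) (ρ.prod volume) := by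
  have h1 : Integrable (fun p : E3 × E3 => η p.2) (ρ.prod volume) := hη.integrable.comp_snd ρ
  have h2 := (measurePreserving_prod_neg_add ρ (volume : Measure E3)).integrable_comp_of_integrable
    h1
  have h3 : Integrable (fun p : E3 × E3 => η (p.2 - p.1)) (ρ.prod volume) := by
    refine h2.congr (.of_forall fun p => ?_)
    simp only [Function.comp]
    congr 1
    abel
  exact h3.mul_bdd (hk.comp measurable_snd).aestronglyMeasurable (.of_forall fun p => hM p.2)

theorem integral_mul_comp_sub (hη : IsEvenKernel η) (k : E3 → ℝ) (y : E3) :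
    ∫ z, η z * k (y - z) = ∫ x, η (x - y) * k x := by
  rw [← integral_sub_left_eq_self (fun z => η z * k (y - z)) volume y]
  refine integral_congr_ae (.of_forall fun x => ?_)
  simp only [sub_sub_cancel]
  rw [← hη.even, neg_sub]

theorem integral_mul_comp_add (hη : IsEvenKernel η) (k : E3 → ℝ) (y : E3) :
    ∫ z, η z * k (y + z) = ∫ z, η z * k (y - z) := by
  rw [← integral_neg_eq_self (fun z => η z * k (y - z)) volume]
  refine integral_congr_ae (.of_forall fun x => ?_)
  simp only [sub_neg_eq_add, hη.even]

theorem integrable_integral (hη : IsEvenKernel η) (ρ : Measure E3) [IsFiniteMeasure ρ]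
    {k : E3 → ℝ} (hk : Measurable k) {M : ℝ} (hM : ∀ x, |k x| ≤ M) :
    Integrable (fun y => ∫ z, η z * k (y - z)) ρ := by
  simp_rw [hη.integral_mul_comp_sub]
  exact (hη.integrable_prod ρ hk hM).integral_prod_left

theorem integral_integral_eq (hη : IsEvenKernel η) (ρ : Measure E3) [IsFiniteMeasure ρ]
    {k : E3 → ℝ} (hk : Measurable k) {M : ℝ} (hM : ∀ x, |k x| ≤ M) :
    ∫ y, (∫ z, η z * k (y - z)) ∂ρ = ∫ x, (∫ y, η (x - y) ∂ρ) * k x := by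
  simp_rw [hη.integral_mul_comp_sub]
  rw [integral_integral_swap (hη.integrable_prod ρ hk hM)]
  simp_rw [integral_mul_const]

theorem integrable_density (hη : IsEvenKernel η) (ρ : Measure E3) [IsFiniteMeasure ρ] :
    Integrable (fun x => ∫ y, η (x - y) ∂ρ) := by
  have := (hη.integrable_prod ρ (k := fun _ => 1) measurable_const (M := 1)
    (by simp)).integral_prod_right
  simpa using this

theorem measurable_density (hη : IsEvenKernel η) (ρ : Measure E3) [IsFiniteMeasure ρ] :
    Measurable (fun x => ∫ y, η (x - y) ∂ρ) := by
  have : StronglyMeasurable (fun p : E3 × E3 => η (p.1 - p.2)) :=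
    (hη.continuous.comp (by fun_prop)).stronglyMeasurable
  exact this.integral_prod_right.measurable

theorem density_nonneg (hη : IsEvenKernel η) (ρ : Measure E3) (x : E3) :
    0 ≤ ∫ y, η (x - y) ∂ρ := integral_nonneg fun _ => hη.nonneg _

theorem isFiniteMeasure_mollify (hη : IsEvenKernel η) (ρ : Measure E3) [IsFiniteMeasure ρ] :
    IsFiniteMeasure (mollify η ρ) :=
  isFiniteMeasure_withDensity_ofReal (hη.integrable_density ρ).2

theorem isFiniteMeasure_marg (hη : IsEvenKernel η) (ρ : Measure E3) [IsFiniteMeasure ρ]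
    (j : Fin 3) : IsFiniteMeasure (marg (mollify η ρ) j) := by
  have := hη.isFiniteMeasure_mollify ρ
  unfold marg
  infer_instance

theorem measurable_integral (hη : IsEvenKernel η) {k : E3 → ℝ} (hk : Measurable k) :
    Measurable fun y => ∫ z, η z * k (y - z) := by
  have : StronglyMeasurable (fun p : E3 × E3 => η p.2 * k (p.1 - p.2)) := by
    refine Measurable.stronglyMeasurable ?_
    exact (hη.continuous.measurable.comp measurable_snd).mul
      (hk.comp (measurable_fst.sub measurable_snd))
  exact this.integral_prod_right.measurable

theorem integrable_mul (hη : IsEvenKernel η) {k : E3 → ℝ} (hk : Measurable k) {M : ℝ}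
    (hM : ∀ x, |k x| ≤ M) : Integrable fun z => η z * k z :=
  hη.integrable.mul_bdd hk.aestronglyMeasurable (.of_forall hM)

theorem integrable_mul_sub (hη : IsEvenKernel η) {k : E3 → ℝ} (hk : Measurable k) {M : ℝ}
    (hM : ∀ x, |k x| ≤ M) (y : E3) : Integrable fun z => η z * k (y - z) :=
  hη.integrable_mul (k := fun z => k (y - z)) (hk.comp (measurable_const.sub measurable_id))
    fun _ => hM _

theorem abs_integral_le (hη : IsEvenKernel η) {k : E3 → ℝ} (hk : Measurable k) {M : ℝ}
    (hM : ∀ x, |k x| ≤ M) (y : E3) : |∫ z, η z * k (y - z)| ≤ M := by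
  calc |∫ z, η z * k (y - z)| ≤ ∫ z, |η z * k (y - z)| := abs_integral_le_integral_abs
    _ ≤ ∫ z, η z * M := by
        refine integral_mono (hη.integrable_mul_sub hk hM y).abs (hη.integrable.mul_const M)
          fun z => ?_
        simp only [abs_mul, abs_of_nonneg (hη.nonneg z)]
        exact mul_le_mul_of_nonneg_left (hM _) (hη.nonneg z)
    _ = M := by rw [integral_mul_const, hη.integral_one, one_mul]

theorem measurable_coord (j : Fin 3) : Measurable fun y : E3 => y j := by fun_prop

theorem integral_marg_mollify (hη : IsEvenKernel η) (ρ : Measure E3) [IsFiniteMeasure ρ]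
    (j : Fin 3) {k : ℝ → ℝ} (hk : Measurable k) {M : ℝ} (hM : ∀ x, |k x| ≤ M) :
    ∫ t, k t ∂(marg (mollify η ρ) j) = ∫ y, (∫ z, η z * k (y j - z j)) ∂ρ := by
  have h := hη.integral_integral_eq ρ (k := fun x => k (x j)) (hk.comp (measurable_coord j))
    fun x => hM _
  simp only [PiLp.sub_apply] at h
  rw [h, marg, integral_map (measurable_coord j).aemeasurable hk.aestronglyMeasurable, mollify,
    integral_withDensity_eq_integral_toReal_smul (hη.measurable_density ρ).ennreal_ofReal
      (.of_forall fun _ => ENNReal.ofReal_lt_top)]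
  refine integral_congr_ae (.of_forall fun x => ?_)
  simp only [ENNReal.toReal_ofReal (hη.density_nonneg ρ x), smul_eq_mul]

theorem measureReal_marg_mollify (hη : IsEvenKernel η) (ρ : Measure E3) [IsFiniteMeasure ρ]
    (j : Fin 3) {s : Set ℝ} (hs : MeasurableSet s) :
    (marg (mollify η ρ) j).real s =
      ∫ y, (∫ z, η z * s.indicator (fun _ => (1:ℝ)) (y j - z j)) ∂ρ := by
  have := hη.isFiniteMeasure_marg ρ j
  rw [← hη.integral_marg_mollify ρ j (measurable_const.indicator hs) (M := 1),
    integral_indicator hs, setIntegral_const, smul_eq_mul, mul_one]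
  intro x
  by_cases h : x ∈ s <;> simp [h]

theorem measureReal_marg_mollify_univ (hη : IsEvenKernel η) (ρ : Measure E3) [IsFiniteMeasure ρ]
    (j : Fin 3) : (marg (mollify η ρ) j).real univ = ρ.real univ := by
  rw [hη.measureReal_marg_mollify ρ j MeasurableSet.univ]
  simp [hη.integral_one]

theorem nullSingletonClass_marg (ρ : Measure E3) (j : Fin 3) :
    NullSingletonClass (marg (mollify η ρ) j) := by
  refine ⟨fun t => ?_⟩
  rw [marg, map_apply (measurable_coord j) (measurableSet_singleton t)]
  refine withDensity_absolutelyContinuous _ _ ?_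
  have h : (volume : Measure (Fin 3 → ℝ)) {f | f j = t} = 0 := by
    rw [volume_pi]
    exact Measure.pi_hyperplane (fun _ : Fin 3 => (volume : Measure ℝ)) j t
  have h2 := (PiLp.volume_preserving_ofLp (Fin 3)).measure_preimage
    (s := {f : Fin 3 → ℝ | f j = t})
    (measurableSet_eq_fun (measurable_pi_apply j) measurable_const).nullMeasurableSet
  rw [h] at h2
  exact h2

end IsEvenKernel

/-- Iterating the kernel `g` twice is the same as applying `g * g`. -/
theorem IsEvenKernel.integral_convFn {g : E3 → ℝ} (hg : IsEvenKernel g) {k : E3 → ℝ}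
    (hk : Measurable k) {M : ℝ} (hM : ∀ x, |k x| ≤ M) (y : E3) :
    ∫ x, convFn g g x * k (y - x) = ∫ u, g u * ∫ v, g v * k (y - u - v) := by
  have hgm : Measurable fun x => ENNReal.ofReal (g x) :=
    hg.continuous.measurable.ennreal_ofReal
  have hfin : IsFiniteMeasure (volume.withDensity fun x => ENNReal.ofReal (g x)) :=
    isFiniteMeasure_withDensity_ofReal hg.integrable.2
  have hw : ∀ f : E3 → ℝ, ∫ x, f x ∂(volume.withDensity fun x => ENNReal.ofReal (g x)) =
      ∫ x, g x * f x := fun f => by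
    rw [integral_withDensity_eq_integral_toReal_smul hgm
      (.of_forall fun _ => ENNReal.ofReal_lt_top)]
    refine integral_congr_ae (.of_forall fun x => ?_)
    simp only [ENNReal.toReal_ofReal (hg.nonneg x), smul_eq_mul]
  have h := hg.integral_integral_eq (volume.withDensity fun x => ENNReal.ofReal (g x))
    (k := fun x => k (y - x)) (hk.comp (measurable_const.sub measurable_id)) fun _ => hM _
  simp only [hw] at h
  refine Eq.trans h.symm (integral_congr_ae (.of_forall fun u => ?_))
  simp only
  rw [← hg.integral_mul_comp_add (fun x => k (y - x)) u]
  simp_rw [sub_sub]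

theorem IsEvenKernel.convFn_self {g : E3 → ℝ} (hg : IsEvenKernel g) :
    IsEvenKernel (convFn g g) where
  continuous := hg.compactSupport.continuous_convolution_right (ContinuousLinearMap.mul ℝ ℝ)
    hg.integrable.locallyIntegrable hg.continuous
  compactSupport :=
    HasCompactSupport.convolution (ContinuousLinearMap.mul ℝ ℝ) hg.compactSupport hg.compactSupport
  nonneg y := integral_nonneg fun z => mul_nonneg (hg.nonneg _) (hg.nonneg _)
  integral_one := by
    have h := hg.integral_convFn (k := fun _ => 1) measurable_const (M := 1) (by simp) 0
    simpa [hg.integral_one] using h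
  even y := by
    rw [convFn, convFn, ← integral_neg_eq_self]
    refine integral_congr_ae (.of_forall fun z => ?_)
    simp only
    rw [hg.even, ← hg.even (y - z)]
    congr 2
    abel

/-- Bounded observables of the `g * g`-mollified marginals are controlled by `tvMol g`. -/
theorem IsEvenKernel.abs_integral_marg_sub_le {g : E3 → ℝ} (hg : IsEvenKernel g)
    (ρ ρ' : Measure E3) [IsFiniteMeasure ρ] [IsFiniteMeasure ρ'] (j : Fin 3) {k : ℝ → ℝ}
    (hk : Measurable k) (hM : ∀ x, |k x| ≤ 1) :
    |(∫ t, k t ∂(marg (mollify (convFn g g) ρ') j)) - ∫ t, k t ∂(marg (mollify (convFn g g) ρ) j)|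
      ≤ tvMol g ρ' ρ := by
  set κ : E3 → ℝ := fun x => ∫ w, g w * k (x j - w j) with hκ
  have hkm : Measurable fun x : E3 => k (x j) := hk.comp (IsEvenKernel.measurable_coord j)
  have hκm : Measurable κ := hg.measurable_integral hkm
  have hκ1 : ∀ x, |κ x| ≤ 1 := fun x => hg.abs_integral_le hkm (fun x => hM _) x
  have key : ∀ (μ : Measure E3) [IsFiniteMeasure μ], ∫ t, k t ∂(marg (mollify (convFn g g) μ) j) =
      ∫ x, (∫ y, g (x - y) ∂μ) * κ x := fun μ _ => by
    rw [hg.convFn_self.integral_marg_mollify μ j hk hM, ← hg.integral_integral_eq μ hκm hκ1]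
    refine integral_congr_ae (.of_forall fun y => ?_)
    exact hg.integral_convFn hkm (fun x => hM _) y
  have hint : ∀ (μ : Measure E3) [IsFiniteMeasure μ],
      Integrable fun x => (∫ y, g (x - y) ∂μ) * κ x := fun μ _ =>
    (hg.integrable_density μ).mul_bdd hκm.aestronglyMeasurable (.of_forall hκ1)
  rw [key ρ', key ρ, ← integral_sub (hint ρ') (hint ρ)]
  refine abs_integral_le_integral_abs.trans (integral_mono ((hint ρ').sub (hint ρ)).abs
    ((hg.integrable_density ρ').sub (hg.integrable_density ρ)).abs fun x => ?_)
  simp only [← sub_mul, abs_mul]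
  exact mul_le_of_le_one_right (abs_nonneg _) (hκ1 x)

theorem IsEvenKernel.abs_measureReal_marg_sub_le {g : E3 → ℝ} (hg : IsEvenKernel g)
    (ρ ρ' : Measure E3) [IsFiniteMeasure ρ] [IsFiniteMeasure ρ'] (j : Fin 3) {s : Set ℝ}
    (hs : MeasurableSet s) :
    |(marg (mollify (convFn g g) ρ') j).real s - (marg (mollify (convFn g g) ρ) j).real s|
      ≤ tvMol g ρ' ρ := by
  have := hg.convFn_self.isFiniteMeasure_marg ρ j
  have := hg.convFn_self.isFiniteMeasure_marg ρ' j
  have h := hg.abs_integral_marg_sub_le ρ ρ' j (k := s.indicator fun _ => 1)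
    (measurable_const.indicator hs) fun x => by by_cases h : x ∈ s <;> simp [h]
  simpa [integral_indicator hs] using h

/-- Integrating `H` recovers the first variation of the regularized median. -/
theorem IsEvenKernel.integral_Hfun {χ : E3 → ℝ} (hχ : IsEvenKernel χ) (q : ℝ)
    (ρ₀ ρ : Measure E3) [IsFiniteMeasure ρ₀] [IsFiniteMeasure ρ] (j : Fin 3) :
    ∫ y, Hfun χ q ρ₀ j y ∂ρ = (2 * q * ρ₀.real univ)⁻¹ *
      medLin q (marg (mollify χ ρ₀) j) (marg (mollify χ ρ) j) := by
  have := hχ.isFiniteMeasure_marg ρ j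
  have hind : ∀ t x : ℝ, |(Iic t).indicator (fun _ => (1:ℝ)) x| ≤ 1 := fun t x => by
    by_cases h : x ∈ Iic t <;> simp only [indicator, h] <;> norm_num
  have hf : ∀ t, Integrable (fchi χ j t) ρ := fun t =>
    hχ.integrable_integral ρ (k := fun x => (Iic t).indicator (fun _ => (1:ℝ)) (x j))
      ((measurable_const.indicator measurableSet_Iic).comp (IsEvenKernel.measurable_coord j))
      fun x => hind t _
  have hF : ∀ t, ∫ y, fchi χ j t y ∂ρ = (marg (mollify χ ρ) j).real (Iic t) := fun t =>
    (hχ.measureReal_marg_mollify ρ j measurableSet_Iic).symm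
  have hlin : ∀ c l t, ∫ y, c * (l - fchi χ j t y) ∂ρ =
      c * (l * (marg (mollify χ ρ) j).real univ - (marg (mollify χ ρ) j).real (Iic t)) := by
    intro c l t
    rw [integral_const_mul, integral_sub (integrable_const _) (hf t), integral_const, hF,
      hχ.measureReal_marg_mollify_univ ρ j, smul_eq_mul, mul_comm l]
  have hlinI : ∀ c l t, Integrable (fun y => c * (l - fchi χ j t y)) ρ := fun c l t =>
    ((integrable_const _).sub (hf t)).const_mul c
  set xm := quantile (marg (mollify χ ρ₀) j) (1/2 - q) with hxm
  set xp := quantile (marg (mollify χ ρ₀) j) (1/2 + q) with hxp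
  set m := medComp q (marg (mollify χ ρ₀) j) with hm
  set k : ℝ → ℝ := fun t => (Icc xm xp).indicator (fun _ => (1:ℝ)) t * (t - m) with hk
  have hkm : Measurable k :=
    (measurable_const.indicator measurableSet_Icc).mul (measurable_id.sub measurable_const)
  have hkb : ∀ t, |k t| ≤ |xm| + |xp| + |m| := by
    intro t
    by_cases h : t ∈ Icc xm xp
    · simp only [hk, indicator_of_mem h, one_mul]
      refine (abs_sub _ _).trans (add_le_add ?_ le_rfl)
      exact (abs_le_max_abs_abs h.1 h.2).trans
        (max_le_add_of_nonneg (abs_nonneg _) (abs_nonneg _))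
    · simp only [hk, indicator_of_notMem h, zero_mul, abs_zero]
      positivity
  have hkint : ∫ y, (∫ z, χ z * k (y j - z j)) ∂ρ =
      ∫ t in Icc xm xp, (t - m) ∂(marg (mollify χ ρ) j) := by
    rw [← hχ.integral_marg_mollify ρ j hkm hkb, ← integral_indicator measurableSet_Icc]
    refine integral_congr_ae (.of_forall fun t => ?_)
    by_cases h : t ∈ Icc xm xp <;> simp only [hk, indicator, h, if_true, if_false] <;> simp
  have hkI : Integrable (fun y => ∫ z, χ z * k (y j - z j)) ρ :=
    hχ.integrable_integral ρ (k := fun x => k (x j))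
      (hkm.comp (IsEvenKernel.measurable_coord j)) fun x => hkb _
  have hH : ∀ y, Hfun χ q ρ₀ j y = (2 * q * ρ₀.real univ)⁻¹ *
      ((∫ z, χ z * k (y j - z j)) + (xp - m) * (1/2 + q - fchi χ j xp y)
        + (m - xm) * (1/2 - q - fchi χ j xm y)) := by
    intro y
    simp only [hk, ← mul_assoc]
    rfl
  simp_rw [hH]
  rw [integral_const_mul, integral_add ?_ (hlinI (m - xm) (1/2 - q) xm),
    integral_add hkI (hlinI (xp - m) (1/2 + q) xp), hlin, hlin, hkint]
  swap; exact hkI.add (hlinI (xp - m) (1/2 + q) xp)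
  rfl

theorem esingle_apply_self (j : Fin 3) : esingle j j = 1 := by simp [esingle]

theorem fchi_congr (χ : E3 → ℝ) (j : Fin 3) {s t : ℝ} {x y : E3} (hxy : x j - s = y j - t) :
    fchi χ j s x = fchi χ j t y := by
  refine integral_congr_ae (.of_forall fun z => ?_)
  simp only [indicator, mem_Iic]
  have : (x j - z j ≤ s) ↔ (y j - z j ≤ t) := by
    constructor <;> intro _ <;> linarith
  simp only [this]

theorem measurable_indicator_Iic_coord (j : Fin 3) (t : ℝ) :
    Measurable fun x : E3 => (Iic t).indicator (fun _ => (1:ℝ)) (x j) :=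
  (measurable_const.indicator measurableSet_Iic).comp (IsEvenKernel.measurable_coord j)

theorem abs_indicator_one_le (s : Set ℝ) (x : ℝ) : |s.indicator (fun _ => (1:ℝ)) x| ≤ 1 := by
  by_cases h : x ∈ s <;> simp [h]

theorem IsEvenKernel.fchi_mono {η : E3 → ℝ} (hη : IsEvenKernel η) (j : Fin 3) (y : E3) {s t : ℝ}
    (hst : s ≤ t) : fchi η j s y ≤ fchi η j t y := by
  refine integral_mono
    (hη.integrable_mul_sub (measurable_indicator_Iic_coord j s) (fun _ => abs_indicator_one_le _ _) y)
    (hη.integrable_mul_sub (measurable_indicator_Iic_coord j t) (fun _ => abs_indicator_one_le _ _) y)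
    fun z => mul_le_mul_of_nonneg_left ?_ (hη.nonneg z)
  exact indicator_le_indicator_of_subset (Iic_subset_Iic.2 hst) (fun _ => zero_le_one) _

/-- Integrated form of the lower bound on the derivative. -/
theorem Adapted.le_fchi_sub {g : E3 → ℝ} {h ℓ : ℝ} (hadapt : Adapted g h ℓ) (hh : 0 < h)
    (j : Fin 3) {s t : ℝ} (y : E3) (hst : s ≤ t) (ht : -(2*ℓ) < y j - t) (hs : y j - s < 2*ℓ) :
    h * (t - s) ≤ fchi g j t y - fchi g j s y := by
  set φ : ℝ → ℝ := fchi g j 0 ∘ fun u => (y j - u) • esingle j with hφ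
  have hφt : ∀ u, fchi g j u y = φ u := fun u =>
    fchi_congr g j (by simp [esingle_apply_self])
  have hd : ∀ u ∈ Icc s t, ∃ D, HasDerivAt φ D u ∧ h ≤ D := by
    intro u hu
    have h1 := hadapt j 0 ((y j - u) • esingle j)
    have hmem : ((y j - u) • esingle j : E3) j ∈ Ioo (0 - 2*ℓ) (0 + 2*ℓ) := by
      simp only [PiLp.smul_apply, esingle_apply_self, smul_eq_mul, mul_one]
      exact ⟨by linarith [hu.2], by linarith [hu.1]⟩
    rw [indicator_of_mem hmem, mul_one] at h1
    have hdiff : DifferentiableAt ℝ (fchi g j 0) ((y j - u) • esingle j) := by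
      by_contra hnd
      rw [fderiv_zero_of_not_differentiableAt hnd] at h1
      simp only [zero_apply, neg_zero] at h1
      linarith
    have hc : HasDerivAt (fun u : ℝ => (y j - u) • esingle j) ((-1 : ℝ) • esingle j) u :=
      ((hasDerivAt_id u).const_sub (y j)).smul_const (esingle j)
    refine ⟨_, hdiff.hasFDerivAt.comp_hasDerivAt u hc, ?_⟩
    rwa [neg_one_smul, map_neg]
  rw [hφt, hφt]
  refine (convex_Icc s t).mul_sub_le_image_sub_of_le_deriv
    (fun u hu => ?_) (fun u hu => ?_) (fun u hu => ?_) s (left_mem_Icc.2 hst) t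
    (right_mem_Icc.2 hst) hst
  · obtain ⟨D, hD, -⟩ := hd u hu
    exact hD.continuousAt.continuousWithinAt
  · obtain ⟨D, hD, -⟩ := hd u (interior_subset hu)
    exact hD.differentiableAt.differentiableWithinAt
  · obtain ⟨D, hD, hle⟩ := hd u (interior_subset hu)
    rwa [hD.deriv]

/-- The lower bound on the derivative, for the kernel `g * g` on the closed window. -/
theorem IsEvenKernel.le_fchi_convFn_sub {g : E3 → ℝ} (hg : IsEvenKernel g) {h ℓ : ℝ}
    (hadapt : Adapted g h ℓ) (hh : 0 < h) (hℓ : 0 < ℓ) (j : Fin 3) {s t : ℝ} (y : E3)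
    (hst : s ≤ t) (hts : t - s ≤ ℓ) (ht : -(2*ℓ) ≤ y j - t) (hs : y j - s ≤ 2*ℓ) :
    h^2 * ℓ * (t - s) ≤ fchi (convFn g g) j t y - fchi (convFn g g) j s y := by
  have hconv : ∀ r, fchi (convFn g g) j r y = ∫ u, g u * fchi g j r (y - u) := fun r =>
    hg.integral_convFn (measurable_indicator_Iic_coord j r) (fun _ => abs_indicator_one_le _ _) y
  have hfm : ∀ r, Measurable (fchi g j r) := fun r =>
    hg.measurable_integral (measurable_indicator_Iic_coord j r)
  have hf1 : ∀ r x, |fchi g j r x| ≤ 1 := fun r x =>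
    hg.abs_integral_le (measurable_indicator_Iic_coord j r) (fun _ => abs_indicator_one_le _ _) x
  have hfI : ∀ r, Integrable fun u => g u * fchi g j r (y - u) := fun r =>
    hg.integrable_mul_sub (hfm r) (hf1 r) y
  obtain ⟨σ, h1, h2, h3, h4⟩ : ∃ σ, -(2*ℓ) < σ ∧ σ + ℓ < 2*ℓ ∧ y j - s - 2*ℓ < σ ∧
      σ + ℓ < y j - t + 2*ℓ := by
    refine ⟨max (y j - s - 2*ℓ) (-(2*ℓ)) + ℓ/2, ?_, ?_, ?_, ?_⟩
    · linarith [le_max_right (y j - s - 2*ℓ) (-(2*ℓ))]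
    · linarith [max_le (show y j - s - 2*ℓ ≤ 0 by linarith) (show -(2*ℓ) ≤ 0 by linarith)]
    · linarith [le_max_left (y j - s - 2*ℓ) (-(2*ℓ))]
    · linarith [max_le (show y j - s - 2*ℓ ≤ y j - t by linarith)
        (show -(2*ℓ) ≤ y j - t by linarith)]
  have hwin := hadapt.le_fchi_sub hh j (s := -σ - ℓ) (t := -σ) 0 (by linarith)
    (by simpa using h1) (by simp only [PiLp.zero_apply]; linarith)
  have hI : ∀ r, Integrable fun u : E3 =>
      g u * (Iic r).indicator (fun _ => (1:ℝ)) ((0 : E3) j - u j) := fun r =>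
    hg.integrable_mul_sub (measurable_indicator_Iic_coord j r) (fun _ => abs_indicator_one_le _ _) 0
  have hmain : h * (t - s) * (fchi g j (-σ) 0 - fchi g j (-σ - ℓ) 0) ≤
      fchi (convFn g g) j t y - fchi (convFn g g) j s y := by
    rw [hconv, hconv, ← integral_sub (hfI t) (hfI s), fchi, fchi, ← integral_sub (hI _) (hI _),
      ← integral_const_mul]
    refine integral_mono (((hI _).sub (hI _)).const_mul _) ((hfI t).sub (hfI s)) fun u => ?_
    simp only [PiLp.zero_apply, ← mul_sub]
    rw [mul_left_comm]
    refine mul_le_mul_of_nonneg_left ?_ (hg.nonneg u)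
    have hmono := hg.fchi_mono j (y - u) hst
    have h0 : 0 ≤ h * (t - s) := mul_nonneg hh.le (by linarith)
    simp only [indicator, mem_Iic]
    by_cases c1 : 0 - u j ≤ -σ - ℓ
    · have c2 : 0 - u j ≤ -σ := by linarith
      rw [if_pos c1, if_pos c2]
      linarith
    · by_cases c2 : 0 - u j ≤ -σ
      · rw [if_neg c1, if_pos c2]
        have := hadapt.le_fchi_sub hh j (s := s) (t := t) (y - u) hst
          (by simp only [PiLp.sub_apply]; linarith) (by simp only [PiLp.sub_apply]; linarith)
        linarith
      · rw [if_neg c1, if_neg c2]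
        linarith
  refine le_trans ?_ hmain
  have h0 : 0 ≤ h * (t - s) := mul_nonneg hh.le (by linarith)
  nlinarith [mul_le_mul_of_nonneg_left hwin h0]

/-- Near a point carrying mass, the distribution function of the mollified marginal grows. -/
theorem IsEvenKernel.le_measureReal_Iic_sub {g : E3 → ℝ} (hg : IsEvenKernel g) {h ℓ β : ℝ}
    (hadapt : Adapted g h ℓ) (hh : 0 < h) (hℓ : 0 < ℓ) (ρ : Measure E3) [IsFiniteMeasure ρ]
    (j : Fin 3) {x s t : ℝ} (hβ : β ≤ ρ.real {y : E3 | |y j - x| ≤ ℓ}) (hst : s ≤ t)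
    (hts : t - s ≤ ℓ) (ht : t ≤ x + ℓ) (hs : x - ℓ ≤ s) :
    h^2 * ℓ * β * (t - s) ≤ (marg (mollify (convFn g g) ρ) j).real (Iic t)
      - (marg (mollify (convFn g g) ρ) j).real (Iic s) := by
  have hχ := hg.convFn_self
  have hfI : ∀ r, Integrable (fchi (convFn g g) j r) ρ := fun r =>
    hχ.integrable_integral ρ (measurable_indicator_Iic_coord j r) fun _ => abs_indicator_one_le _ _
  have hF : ∀ r, (marg (mollify (convFn g g) ρ) j).real (Iic r) =
      ∫ y, fchi (convFn g g) j r y ∂ρ := fun r =>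
    hχ.measureReal_marg_mollify ρ j measurableSet_Iic
  have hS : MeasurableSet {y : E3 | |y j - x| ≤ ℓ} :=
    measurableSet_le (by fun_prop) measurable_const
  have hc : 0 ≤ h^2 * ℓ * (t - s) := by
    have : 0 ≤ t - s := by linarith
    positivity
  rw [hF, hF, ← integral_sub (hfI t) (hfI s)]
  calc h^2 * ℓ * β * (t - s) = (h^2 * ℓ * (t - s)) * β := by ring
    _ ≤ (h^2 * ℓ * (t - s)) * ρ.real {y : E3 | |y j - x| ≤ ℓ} := mul_le_mul_of_nonneg_left hβ hc
    _ = ∫ y, {y : E3 | |y j - x| ≤ ℓ}.indicator (fun _ => h^2 * ℓ * (t - s)) y ∂ρ := by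
        rw [integral_indicator hS, setIntegral_const, smul_eq_mul, mul_comm]
    _ ≤ _ := by
        refine integral_mono ((integrable_const _).indicator hS) ((hfI t).sub (hfI s)) fun y => ?_
        by_cases hy : |y j - x| ≤ ℓ
        · rw [indicator_of_mem (show y ∈ {y : E3 | |y j - x| ≤ ℓ} from hy)]
          rw [abs_le] at hy
          exact hg.le_fchi_convFn_sub hadapt hh hℓ j y hst hts (by linarith) (by linarith)
        · rw [indicator_of_notMem (show y ∉ {y : E3 | |y j - x| ≤ ℓ} from hy)]
          exact sub_nonneg.2 (hχ.fchi_mono j y hst)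

theorem IsEvenKernel.mul_abs_sub_le_abs_measureReal_sub {g : E3 → ℝ} (hg : IsEvenKernel g)
    {h ℓ β W : ℝ} (hadapt : Adapted g h ℓ) (hh : 0 < h) (hℓ : 0 < ℓ) (hβ0 : 0 < β) (hW : 0 ≤ W)
    (ρ : Measure E3) [IsFiniteMeasure ρ] (j : Fin 3) {x t : ℝ}
    (hβ : β ≤ ρ.real {y : E3 | |y j - x| ≤ ℓ}) (ht : |t - x| ≤ W) :
    h^2 * ℓ * β * ℓ / (W + ℓ) * |t - x| ≤ |(marg (mollify (convFn g g) ρ) j).real (Iic t)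
      - (marg (mollify (convFn g g) ρ) j).real (Iic x)| := by
  have := hg.convFn_self.isFiniteMeasure_marg ρ j
  have hmono : ∀ {a b : ℝ}, a ≤ b → (marg (mollify (convFn g g) ρ) j).real (Iic a) ≤
      (marg (mollify (convFn g g) ρ) j).real (Iic b) := fun hab =>
    measureReal_mono (Iic_subset_Iic.2 hab)
  have hc : 0 < h^2 * ℓ * β := by positivity
  have hscale : h^2 * ℓ * β * ℓ / (W + ℓ) * |t - x| ≤ h^2 * ℓ * β * min |t - x| ℓ := by
    rw [mul_div_assoc, mul_assoc]
    refine mul_le_mul_of_nonneg_left ?_ hc.le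
    rw [div_mul_eq_mul_div, div_le_iff₀ (by linarith)]
    rcases le_total |t - x| ℓ with h' | h'
    · rw [min_eq_left h']
      nlinarith [abs_nonneg (t - x)]
    · rw [min_eq_right h']
      nlinarith [abs_nonneg (t - x)]
  refine hscale.trans ?_
  rcases le_total x t with hxt | hxt
  · rw [abs_of_nonneg (sub_nonneg.2 hxt)]
    refine le_trans ?_ (le_abs_self _)
    have h1 := hg.le_measureReal_Iic_sub hadapt hh hℓ ρ j (s := x) (t := x + min (t - x) ℓ) hβ
      (by linarith [le_min (sub_nonneg.2 hxt) hℓ.le]) (by linarith [min_le_right (t - x) ℓ])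
      (by linarith [min_le_right (t - x) ℓ]) (by linarith)
    have h2 := hmono (show x + min (t - x) ℓ ≤ t by linarith [min_le_left (t - x) ℓ])
    rw [add_sub_cancel_left] at h1
    linarith
  · rw [abs_sub_comm, abs_of_nonneg (sub_nonneg.2 hxt), abs_sub_comm]
    refine le_trans ?_ (le_abs_self _)
    have h1 := hg.le_measureReal_Iic_sub hadapt hh hℓ ρ j (s := x - min (x - t) ℓ) (t := x) hβ
      (by linarith [le_min (sub_nonneg.2 hxt) hℓ.le]) (by linarith [min_le_right (x - t) ℓ])
      (by linarith) (by linarith [min_le_right (x - t) ℓ])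
    have h2 := hmono (show t ≤ x - min (x - t) ℓ by linarith [min_le_left (x - t) ℓ])
    rw [sub_sub_cancel] at h1
    linarith

/-- A measure whose pair correlation is small concentrates on a ball. -/
theorem exists_measureReal_compl_closedBall_lt (ρ : Measure E3) [IsFiniteMeasure ρ] {θ R δ : ℝ}
    (hR : 0 ≤ R) (hθ : 0 < θ) (hθN : θ < ρ.real univ / 2) (hδθ : δ ≤ θ * ρ.real univ)
    (hpair : (ρ.prod ρ).real {p : E3 × E3 | R < dist p.1 p.2} ≤ δ) :
    ∃ x, ρ.real (closedBall x (2*R))ᶜ < θ := by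
  by_contra! hcon
  have hN : 0 < ρ.real univ := by linarith
  have hne : NeZero ρ := ⟨by rintro rfl; simp at hN⟩
  set S := {p : E3 × E3 | R < dist p.1 p.2} with hS
  have hSm : MeasurableSet S :=
    (isOpen_lt continuous_const (by fun_prop)).measurableSet
  have hsec : ∀ x, Prod.mk x ⁻¹' S = (closedBall x R)ᶜ := fun x => by
    ext y
    simp [hS, dist_comm]
  set p : E3 → ℝ := fun x => ρ.real (closedBall x R)ᶜ with hp
  have hpI : Integrable p ρ := by
    have := Measure.integrable_measure_prodMk_left hSm (measure_ne_top (ρ.prod ρ) S)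
    simpa only [hsec] using this
  have hint : ∫ x, p x ∂ρ = (ρ.prod ρ).real S := by
    rw [Measure.real, Measure.prod_apply hSm, ← integral_toReal]
    · simp only [hsec]; rfl
    · exact (measurable_measure_prodMk_left hSm).aemeasurable
    · exact .of_forall fun x => measure_lt_top _ _
  have hmem : ∀ {x y : E3}, p x < ρ.real univ / 2 → p y < ρ.real univ / 2 → dist y x ≤ 2*R := by
    intro x y hx hy
    by_contra! hlt
    have hsub : univ ⊆ (closedBall x R)ᶜ ∪ (closedBall y R)ᶜ := by
      intro z _
      by_contra hz
      simp only [mem_union, mem_compl_iff, mem_closedBall, not_or, not_not] at hz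
      have := dist_triangle_left y x z
      linarith [hz.1, hz.2]
    have := (measureReal_mono (μ := ρ) hsub).trans (measureReal_union_le _ _)
    simp only [hp] at hx hy
    linarith
  have hpθ : ∀ x, θ ≤ p x := fun x =>
    (hcon x).trans (measureReal_mono (compl_subset_compl.2 (closedBall_subset_closedBall
      (by linarith))))
  have hae : ∀ᵐ x ∂ρ, p x = θ := by
    have h0 : ∫ x, (p x - θ) ∂ρ ≤ 0 := by
      rw [integral_sub hpI (integrable_const _), hint, integral_const, smul_eq_mul]
      linarith
    have h1 := (integral_eq_zero_iff_of_nonneg (f := fun x => p x - θ)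
      (fun x => sub_nonneg.2 (hpθ x)) (hpI.sub (integrable_const _))).1
      (le_antisymm h0 (integral_nonneg fun x => sub_nonneg.2 (hpθ x)))
    filter_upwards [h1] with x hx using sub_eq_zero.1 hx
  obtain ⟨x, hx⟩ := hae.exists
  have hzero : ρ.real (closedBall x (2*R))ᶜ = 0 := by
    rw [measureReal_eq_zero_iff]
    refine measure_mono_null ?_ (ae_iff.1 hae)
    intro y hy hyp
    exact hy (hmem (by rw [hx]; exact hθN) (by rw [hyp]; exact hθN))
  linarith [hcon x]

theorem MassCond.exists_center {d D δ R q : ℝ} (hd : 0 < d) (hδ0 : 0 < δ) (hδ : δ < d^2/2)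
    (hqδ : q ≤ 1/2 - δ/d^2) (hR : 0 < R) {ρ : Measure E3} [IsFiniteMeasure ρ]
    (hρ : MassCond d D δ R ρ) :
    ∃ x, ρ.real (closedBall x (2*R))ᶜ < (1/2 - q) * ρ.real univ := by
  obtain ⟨hdN, -, hpair⟩ := hρ
  change d ≤ ρ.real univ at hdN
  have hN : 0 < ρ.real univ := hd.trans_le hdN
  have h1 : δ / d^2 < 1/2 := by rw [div_lt_iff₀ (by positivity)]; linarith
  have h0 : 0 < δ / d^2 := by positivity
  obtain ⟨x, hx⟩ := exists_measureReal_compl_closedBall_lt ρ (θ := δ / d^2 * ρ.real univ) (R := R)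
    hR.le (by positivity) (by nlinarith) (by
      rw [mul_assoc, ← sq, div_mul_eq_mul_div, le_div_iff₀ (by positivity)]
      gcongr) hpair
  exact ⟨x, hx.trans_le (by gcongr; linarith)⟩

theorem measureReal_marg_compl_Icc_le (ρ : Measure E3) [IsFiniteMeasure ρ] (j : Fin 3) (x : E3)
    (r : ℝ) {a b : ℝ} (ha : a ≤ x j - r) (hb : x j + r ≤ b) :
    (marg ρ j).real (Icc a b)ᶜ ≤ ρ.real (closedBall x r)ᶜ := by
  rw [marg, map_measureReal_apply (IsEvenKernel.measurable_coord j) measurableSet_Icc.compl]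
  refine measureReal_mono fun y hy hy' => hy ?_
  have h1 : ‖(y - x) j‖ ≤ r := (PiLp.norm_apply_le (y - x) j).trans (by
    rw [← dist_eq_norm]; exact hy')
  rw [PiLp.sub_apply, Real.norm_eq_abs, abs_le] at h1
  exact ⟨by linarith, by linarith⟩

theorem IsEvenKernel.measureReal_marg_mollify_compl_Icc_le {η : E3 → ℝ} (hη : IsEvenKernel η)
    (ρ : Measure E3) [IsFiniteMeasure ρ] (j : Fin 3) (x : E3) {r s a b : ℝ}
    (hs : ∀ z, η z ≠ 0 → ‖z‖ ≤ s) (ha : a ≤ x j - r - s) (hb : x j + r + s ≤ b) :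
    (marg (mollify η ρ) j).real (Icc a b)ᶜ ≤ ρ.real (closedBall x r)ᶜ := by
  have hS : MeasurableSet (closedBall x r)ᶜ := measurableSet_closedBall.compl
  rw [hη.measureReal_marg_mollify ρ j measurableSet_Icc.compl]
  have hk : Measurable fun y : E3 => (Icc a b)ᶜ.indicator (fun _ => (1:ℝ)) (y j) :=
    (measurable_const.indicator measurableSet_Icc.compl).comp (IsEvenKernel.measurable_coord j)
  have hI := hη.integrable_integral ρ hk (M := 1) fun _ => abs_indicator_one_le _ _
  calc _ ≤ ∫ y, (closedBall x r)ᶜ.indicator (fun _ => (1:ℝ)) y ∂ρ := by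
        refine integral_mono hI ((integrable_const _).indicator hS) fun y => ?_
        by_cases hy : y ∈ closedBall x r
        · rw [indicator_of_notMem (by simpa using hy)]
          refine (integral_eq_zero_of_ae (.of_forall fun z => ?_)).le
          by_cases hz : η z = 0
          · simp [hz]
          · have h1 : ‖(y - x) j‖ ≤ r := (PiLp.norm_apply_le (y - x) j).trans (by
              rw [← dist_eq_norm]; exact hy)
            have h2 : ‖z j‖ ≤ s := (PiLp.norm_apply_le z j).trans (hs z hz)
            rw [PiLp.sub_apply, Real.norm_eq_abs, abs_le] at h1
            rw [Real.norm_eq_abs, abs_le] at h2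
            have h3 : (y - z) j ∈ Icc a b := by
              rw [PiLp.sub_apply]
              exact ⟨by linarith, by linarith⟩
            simp only [Pi.zero_apply]
            rw [indicator_of_notMem (by simpa using h3), mul_zero]
        · rw [indicator_of_mem (show y ∈ (closedBall x r)ᶜ from hy)]
          exact (le_abs_self _).trans (hη.abs_integral_le hk (fun _ => abs_indicator_one_le _ _) y)
    _ = _ := by rw [integral_indicator hS, setIntegral_const, smul_eq_mul, mul_one]

theorem abs_medComp_marg_sub_le (ρ : Measure E3) [IsFiniteMeasure ρ] (j : Fin 3) {x : E3}
    {q qt r : ℝ} (hqt0 : 0 < qt) (hqt : qt ≤ q) (hq : q < 1/2)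
    (hx : ρ.real (closedBall x r)ᶜ < (1/2 - q) * ρ.real univ) :
    |medComp qt (marg ρ j) - x j| ≤ r := by
  have : IsFiniteMeasure (marg ρ j) := by unfold marg; infer_instance
  have huniv : (marg ρ j).real univ = ρ.real univ := by
    rw [marg, map_measureReal_apply (IsEvenKernel.measurable_coord j) MeasurableSet.univ,
      preimage_univ]
  have h := medComp_mem_Icc (marg ρ j) (a := x j - r) (b := x j + r) hqt0 (hqt.trans_lt hq) (by
    rw [huniv]
    refine (measureReal_marg_compl_Icc_le ρ j x r le_rfl le_rfl).trans_lt (hx.trans_le ?_)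
    gcongr)
  rw [abs_le]
  exact ⟨by linarith [h.1], by linarith [h.2]⟩

theorem abs_medComp_sub_le_norm_med_sub (q : ℝ) (ρ ρ' : Measure E3) (j : Fin 3) :
    |medComp q (marg ρ' j) - medComp q (marg ρ j)| ≤ ‖med q ρ' - med q ρ‖ :=
  PiLp.norm_apply_le (med q ρ' - med q ρ) j

theorem norm_vec3_le {f : Fin 3 → ℝ} {K : ℝ} (hf : ∀ j, |f j| ≤ K) : ‖vec3 f‖ ≤ 3 * K := by
  have hK : 0 ≤ K := (abs_nonneg _).trans (hf 0)
  rw [EuclideanSpace.norm_eq]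
  refine Real.sqrt_le_iff.2 ⟨by positivity, ?_⟩
  rw [Fin.sum_univ_three]
  have h : ∀ j, ‖vec3 f j‖^2 ≤ K^2 := fun j => by
    gcongr
    exact hf j
  nlinarith [h 0, h 1, h 2]

theorem IsEvenKernel.abs_medComp_expansion_le {g : E3 → ℝ} (hg : IsEvenKernel g)
    {h ℓ q β d D δ R R' r : ℝ} (hh : 0 < h) (hℓ : 0 < ℓ) (hadapt : Adapted g h ℓ)
    (hq0 : 0 < q) (hq : q < 1/2) (hβ : 0 < β) (hd : 0 < d) (hδ0 : 0 < δ)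
    (hR : 0 < R) (hR' : 0 < R') (hδ : δ < d^2/2) (hqδ : q ≤ 1/2 - δ/d^2) (hr : 0 ≤ r)
    (hgr : ∀ z, convFn g g z ≠ 0 → ‖z‖ ≤ r)
    {ρ₀ ρ ρ' : Measure E3} [IsFiniteMeasure ρ₀] [IsFiniteMeasure ρ] [IsFiniteMeasure ρ']
    (hadm : Admissible (convFn g g) q ℓ β d D δ R R' ρ₀ ρ ρ') (j : Fin 3) :
    |medComp q (marg (mollify (convFn g g) ρ) j)
        + ((∫ y, Hfun (convFn g g) q ρ₀ j y ∂ρ') - ∫ y, Hfun (convFn g g) q ρ₀ j y ∂ρ)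
        - medComp q (marg (mollify (convFn g g) ρ') j)| ≤
      (2 * (2 * (R' + 6*R + r)) / (q*d)
        + 24 / (h^2 * ℓ * β * ℓ / (2 * (R' + 6*R + r) + ℓ) * q)) / d
        * tvMol g ρ' ρ * (tvMol g ρ' ρ + tvMol g ρ ρ₀) := by
  have hχ := hg.convFn_self
  obtain ⟨⟨qt, hqt0, hqt, hmed⟩, hρ₀, hρ, hρ', hwin⟩ := hadm
  obtain ⟨x₀, hx₀⟩ := hρ₀.exists_center hd hδ0 hδ hqδ hR
  obtain ⟨x, hx⟩ := hρ.exists_center hd hδ0 hδ hqδ hR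
  obtain ⟨x', hx'⟩ := hρ'.exists_center hd hδ0 hδ hqδ hR
  have c₀ := abs_le.1 (abs_medComp_marg_sub_le ρ₀ j hqt0 hqt hq hx₀)
  have c := abs_le.1 (abs_medComp_marg_sub_le ρ j hqt0 hqt hq hx)
  have c' := abs_le.1 (abs_medComp_marg_sub_le ρ' j hqt0 hqt hq hx')
  have n₁ := norm_nonneg (med qt ρ' - med qt ρ)
  have n₂ := norm_nonneg (med qt ρ - med qt ρ₀)
  have m₁ := abs_le.1 (abs_medComp_sub_le_norm_med_sub qt ρ ρ' j)
  have m₂ := abs_le.1 (abs_medComp_sub_le_norm_med_sub qt ρ₀ ρ j)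
  have hfin₀ := hχ.isFiniteMeasure_marg ρ₀ j
  have hfin := hχ.isFiniteMeasure_marg ρ j
  have hfin' := hχ.isFiniteMeasure_marg ρ' j
  have hns₀ := IsEvenKernel.nullSingletonClass_marg (η := convFn g g) ρ₀ j
  have hns := IsEvenKernel.nullSingletonClass_marg (η := convFn g g) ρ j
  have hns' := IsEvenKernel.nullSingletonClass_marg (η := convFn g g) ρ' j
  set W := 2 * (R' + 6*R + r) with hW
  have hW0 : 0 < W := by positivity
  set A := x₀ j - (R' + 6*R + r) with hA
  set B := x₀ j + (R' + 6*R + r) with hB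
  have hBA : B - A = W := by rw [hA, hB, hW]; ring
  have hu := fun (μ : Measure E3) [IsFiniteMeasure μ] => hχ.measureReal_marg_mollify_univ μ j
  have hmass : ∀ (μ : Measure E3) [IsFiniteMeasure μ] (z : E3),
      μ.real (closedBall z (2*R))ᶜ < (1/2 - q) * μ.real univ →
      x₀ j - (R' + 4*R) ≤ z j → z j ≤ x₀ j + (R' + 4*R) →
      (marg (mollify (convFn g g) μ) j).real (Icc A B)ᶜ <
        (1/2 - q) * (marg (mollify (convFn g g) μ) j).real univ := by
    intro μ _ z hz h1 h2
    rw [hu μ]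
    exact (hχ.measureReal_marg_mollify_compl_Icc_le μ j z hgr (by linarith)
      (by linarith)).trans_lt hz
  have hν₀ := hmass ρ₀ x₀ hx₀ (by linarith) (by linarith)
  have hν := hmass ρ x hx (by linarith [c₀.1, c₀.2, c.1, c.2, m₂.1, m₂.2])
    (by linarith [c₀.1, c₀.2, c.1, c.2, m₂.1, m₂.2])
  have hν' := hmass ρ' x' hx' (by linarith [c₀.1, c₀.2, c'.1, c'.2, m₁.1, m₁.2, m₂.1, m₂.2])
    (by linarith [c₀.1, c₀.2, c'.1, c'.2, m₁.1, m₁.2, m₂.1, m₂.2])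
  obtain ⟨q₁, q₂, q₃⟩ := quantile_mem_Icc _ hq0 hν₀
  have hdist : ∀ {s t : ℝ}, t ∈ Icc A B → A ≤ s → s ≤ B → |t - s| ≤ W := fun ht h1 h2 => by
    rw [abs_le]
    exact ⟨by linarith [ht.1], by linarith [ht.2]⟩
  have hkey := abs_medComp_add_medLin_sub_le
    (marg (mollify (convFn g g) ρ₀) j) (marg (mollify (convFn g g) ρ) j)
    (marg (mollify (convFn g g) ρ') j) (q := q) (A := A) (B := B)
    (a := tvMol g ρ' ρ) (b := tvMol g ρ ρ₀) (c := h^2 * ℓ * β * ℓ / (W + ℓ)) (d := d)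
    hq0 hq (by positivity) hd (by linarith)
    ((hu ρ₀).symm ▸ hρ₀.1) ((hu ρ).symm ▸ hρ.1) ((hu ρ').symm ▸ hρ'.1) hν₀ hν hν'
    (fun t => hg.abs_measureReal_marg_sub_le ρ ρ' j measurableSet_Iic)
    (hg.abs_measureReal_marg_sub_le ρ ρ' j MeasurableSet.univ)
    (fun t => hg.abs_measureReal_marg_sub_le ρ₀ ρ j measurableSet_Iic)
    (hg.abs_measureReal_marg_sub_le ρ₀ ρ j MeasurableSet.univ)
    (fun t ht => hg.mul_abs_sub_le_abs_measureReal_sub hadapt hh hℓ hβ hW0.le ρ₀ j (hwin j).2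
      (hdist ht q₁ (q₂.trans q₃)))
    (fun t ht => hg.mul_abs_sub_le_abs_measureReal_sub hadapt hh hℓ hβ hW0.le ρ₀ j (hwin j).1
      (hdist ht (q₁.trans q₂) q₃))
  rw [hu ρ₀, mul_sub, ← hχ.integral_Hfun, ← hχ.integral_Hfun, hBA] at hkey
  exact hkey

/-- differentiability of the regularized median (mollified total variation
version), for `χ = g*g`. -/
theorem stmt4 (g : E3 → ℝ) (hg : IsMollifier g) (hrot : RotInv g)
    (h ℓ : ℝ) (hh : 0 < h) (hℓ : 0 < ℓ) (hadapt : Adapted g h ℓ)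
    (q β d D δ R R' : ℝ)
    (hq0 : 0 < q) (hq : q < 1/2) (hβ : 0 < β) (hd : 0 < d) (hD : 0 < D) (hδ0 : 0 < δ)
    (hR : 0 < R) (hR' : 0 < R') (hδ : δ < d^2/2) (hqδ : q ≤ 1/2 - δ/d^2) :
    ∃ C > (0:ℝ),
      ∀ (ρ₀ ρ ρ' : Measure E3) [IsFiniteMeasure ρ₀] [IsFiniteMeasure ρ] [IsFiniteMeasure ρ'],
        Admissible (convFn g g) q ℓ β d D δ R R' ρ₀ ρ ρ' →
        ‖med q (mollify (convFn g g) ρ)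
            + vec3 (fun j => (∫ y, Hfun (convFn g g) q ρ₀ j y ∂ρ')
                - ∫ y, Hfun (convFn g g) q ρ₀ j y ∂ρ)
            - med q (mollify (convFn g g) ρ')‖
          ≤ C * tvMol g ρ' ρ * (tvMol g ρ' ρ + tvMol g ρ ρ₀) := by
  have hgk := hg.isEvenKernel hrot
  obtain ⟨r, hr, hgr⟩ : ∃ r : ℝ, 0 ≤ r ∧ ∀ z, convFn g g z ≠ 0 → ‖z‖ ≤ r := by
    obtain ⟨r, hr⟩ := hgk.convFn_self.compactSupport.isCompact.isBounded.exists_norm_le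
    exact ⟨max r 0, le_max_right _ _, fun z hz =>
      (hr z (subset_tsupport _ (Function.mem_support.2 hz))).trans (le_max_left _ _)⟩
  refine ⟨3 * ((2 * (2 * (R' + 6*R + r)) / (q*d)
    + 24 / (h^2 * ℓ * β * ℓ / (2 * (R' + 6*R + r) + ℓ) * q)) / d), by positivity, ?_⟩
  intro ρ₀ ρ ρ' _ _ _ hadm
  have hcomp := hgk.abs_medComp_expansion_le hh hℓ hadapt hq0 hq hβ hd hδ0 hR hR' hδ hqδ hr hgr hadm
  refine (norm_vec3_le hcomp).trans_eq ?_
  ring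

end
end

section
/- Let χ be a mollifier on ℝ³ whose support is contained in the closed ball of radius R₀ centered at the origin, and let 0 < q < 1/2. Then for every nonzero finite Borel measure ρ on ℝ³ and every s > 0: if |m_q(χ*ρ)| ≥ s, then ρ({y ∈ ℝ³ : |y| ≥ s/3 − R₀}) ≥ (1/2 − q)·ρ(ℝ³). -/
open MeasureTheory Measure Set Metric Filter
open scoped ENNReal NNReal RealInnerProductSpace BigOperators FourierTransform

noncomputable section

/-- The mollified measure of a set is an iterated integral with the kernel `χ(x - y)`. -/
theorem mollify_apply {χ : E3 → ℝ} (hχ : IsMollifier χ) (ρ : Measure E3) [IsFiniteMeasure ρ]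
    {A : Set E3} (hA : MeasurableSet A) :
    mollify χ ρ A = ∫⁻ y, (∫⁻ x in A, ENNReal.ofReal (χ (x - y))) ∂ρ := by
  have hc : Continuous χ := hχ.smooth.continuous
  have hint : ∀ x, Integrable (fun y => χ (x - y)) ρ := fun x =>
    Integrable.of_bound (C := 1) (by fun_prop) (Eventually.of_forall fun y => by
      rw [Real.norm_of_nonneg (hχ.mem_Icc _).1]; exact (hχ.mem_Icc _).2)
  rw [mollify, withDensity_apply _ hA, lintegral_lintegral_swap]
  · refine lintegral_congr fun x => ?_
    exact ofReal_integral_eq_lintegral_ofReal (hint x)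
      (Eventually.of_forall fun y => (hχ.mem_Icc _).1)
  · exact Measurable.aemeasurable (by unfold Function.uncurry; fun_prop)

theorem IsMollifier.lintegral_sub {χ : E3 → ℝ} (hχ : IsMollifier χ) (y : E3) :
    ∫⁻ x, ENNReal.ofReal (χ (x - y)) = 1 := by
  rw [lintegral_sub_right_eq_self (fun x => ENNReal.ofReal (χ x)) y,
    ← ofReal_integral_eq_lintegral_ofReal
      (hχ.smooth.continuous.integrable_of_hasCompactSupport hχ.compactSupport)
      (Eventually.of_forall fun x => (hχ.mem_Icc x).1), hχ.integral_one, ENNReal.ofReal_one]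

theorem mollify_univ {χ : E3 → ℝ} (hχ : IsMollifier χ) (ρ : Measure E3) [IsFiniteMeasure ρ] :
    mollify χ ρ univ = ρ univ := by
  rw [mollify_apply hχ ρ MeasurableSet.univ]
  simp [hχ.lintegral_sub]

/-- Mollification moves mass by at most the support of `χ`. -/
theorem mollify_apply_le {χ : E3 → ℝ} (hχ : IsMollifier χ) (ρ : Measure E3) [IsFiniteMeasure ρ]
    {A B : Set E3} (hA : MeasurableSet A) (hB : MeasurableSet B)
    (hAB : ∀ x ∈ A, ∀ y, χ (x - y) ≠ 0 → y ∈ B) :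
    mollify χ ρ A ≤ ρ B := by
  rw [mollify_apply hχ ρ hA, ← lintegral_indicator_one hB]
  refine lintegral_mono fun y => ?_
  by_cases hy : y ∈ B
  · simpa [hy] using (setLIntegral_le_lintegral A _).trans (hχ.lintegral_sub y).le
  · rw [setLIntegral_congr_fun (g := fun _ => 0) hA fun x hx => ?_]
    · simp
    · have : χ (x - y) = 0 := by_contra fun h => hy (hAB x hx y h)
      simp [this]

theorem measure_Iic_le_of_lt_quantile {ν : Measure ℝ} [IsFiniteMeasure ν] {lam t : ℝ}
    (ht : t < quantile ν lam) (h0 : quantile ν lam ≠ 0) :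
    ν.real (Iic t) ≤ lam * ν.real univ := by
  have hne : {t : ℝ | (ν (Iic t)).toReal ≤ lam * (ν univ).toReal}.Nonempty := by
    by_contra h
    rw [not_nonempty_iff_eq_empty] at h
    exact h0 (by rw [quantile, h, Real.sSup_empty])
  obtain ⟨u, hu, htu⟩ := exists_lt_of_lt_csSup hne ht
  exact (measureReal_mono (Iic_subset_Iic.2 htu.le)).trans hu

theorem lt_measure_Iic_of_quantile_lt {ν : Measure ℝ} {lam t : ℝ}
    (ht : quantile ν lam < t) (h0 : quantile ν lam ≠ 0) :
    lam * ν.real univ < ν.real (Iic t) := by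
  have hb : BddAbove {t : ℝ | (ν (Iic t)).toReal ≤ lam * (ν univ).toReal} := by
    by_contra h
    exact h0 (Real.sSup_of_not_bddAbove h)
  exact not_le.1 fun h => ht.not_ge (le_csSup hb h)

/-- A nonzero regularized median lies in its quantile window. -/
theorem medComp_mem_Icc_s8 {q : ℝ} {ν : Measure ℝ} [IsFiniteMeasure ν] (h : medComp q ν ≠ 0) :
    medComp q ν ∈ Icc (quantile ν (1/2 - q)) (quantile ν (1/2 + q)) := by
  set a := quantile ν (1/2 - q) with ha
  set b := quantile ν (1/2 + q) with hb
  have hm : medComp q ν = (∫ t in Icc a b, t ∂ν) / ν.real (Icc a b) := rfl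
  have hK : ν.real (Icc a b) ≠ 0 := fun h0 => h (by rw [hm, h0, div_zero])
  have hpos : 0 < ν.real (Icc a b) := lt_of_le_of_ne measureReal_nonneg hK.symm
  have hint : IntegrableOn (fun t : ℝ => t) (Icc a b) ν :=
    continuous_id.continuousOn.integrableOn_compact isCompact_Icc
  have hl : ∫ _ in Icc a b, a ∂ν ≤ ∫ t in Icc a b, t ∂ν :=
    setIntegral_mono_on (integrable_const _) hint measurableSet_Icc fun _ ht => ht.1
  have hr : ∫ t in Icc a b, t ∂ν ≤ ∫ _ in Icc a b, b ∂ν :=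
    setIntegral_mono_on hint (integrable_const _) measurableSet_Icc fun _ ht => ht.2
  simp only [setIntegral_const, smul_eq_mul] at hl hr
  rw [hm]
  exact ⟨(le_div_iff₀ hpos).2 (by linarith), (div_le_iff₀ hpos).2 (by linarith)⟩

/-- A vector of `ℝ³` with norm at least `s > 0` has a coordinate larger than `s / 3`. -/
theorem exists_div_three_lt_abs_coord {v : E3} {s : ℝ} (hs : 0 < s) (hv : s ≤ ‖v‖) :
    ∃ j, s / 3 < |v j| := by
  by_contra! h
  have hsq : s ^ 2 ≤ ‖v‖ ^ 2 := by gcongr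
  rw [EuclideanSpace.real_norm_sq_eq, Fin.sum_univ_three] at hsq
  have hj : ∀ j, v j ^ 2 ≤ (s / 3) ^ 2 := fun j => sq_le_sq' (abs_le.1 (h j)).1 (abs_le.1 (h j)).2
  nlinarith [hj 0, hj 1, hj 2, pow_pos hs 2]

/-- a large regularized median forces mass far from the origin. -/
theorem stmt8 (χ : E3 → ℝ) (hχ : IsMollifier χ) (R₀ : ℝ)
    (hsupp : Function.support χ ⊆ Metric.closedBall (0:E3) R₀)
    (q : ℝ) (hq0 : 0 < q) (hq : q < 1/2)
    (ρ : Measure E3) [IsFiniteMeasure ρ] (hρ : ρ ≠ 0) (s : ℝ) (hs : 0 < s)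
    (hmed : s ≤ ‖med q (mollify χ ρ)‖) :
    (1/2 - q) * (ρ Set.univ).toReal ≤ (ρ {y : E3 | s/3 - R₀ ≤ ‖y‖}).toReal := by
  obtain ⟨j, hj⟩ := exists_div_three_lt_abs_coord hs hmed
  set ν := marg (mollify χ ρ) j with hν
  have hcoord : Measurable fun y : E3 => y j := by fun_prop
  have hj' : s / 3 < |medComp q ν| := hj
  have huniv : ν univ = ρ univ := by
    rw [hν, marg, map_apply hcoord MeasurableSet.univ, preimage_univ, mollify_univ hχ]
  have : IsFiniteMeasure ν := ⟨huniv ▸ measure_lt_top ρ univ⟩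
  have hM : ν.real univ = (ρ univ).toReal := by rw [measureReal_def, huniv]
  have hfar : ∀ S : Set ℝ, MeasurableSet S → (∀ t ∈ S, s / 3 ≤ |t|) →
      ν.real S ≤ (ρ {y : E3 | s/3 - R₀ ≤ ‖y‖}).toReal := by
    intro S hS hSs
    refine ENNReal.toReal_mono (measure_ne_top _ _) ?_
    rw [hν, marg, map_apply hcoord hS]
    refine mollify_apply_le hχ ρ (hcoord hS) (measurableSet_le measurable_const measurable_norm) ?_
    intro x hx y hxy
    have h1 : ‖x - y‖ ≤ R₀ := by simpa using hsupp hxy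
    have h2 : |x j| ≤ ‖x‖ := PiLp.norm_apply_le x j
    have h3 : ‖x‖ ≤ ‖x - y‖ + ‖y‖ := by simpa using norm_add_le (x - y) y
    have h4 : s / 3 ≤ |x j| := hSs _ hx
    simp only [mem_ofPred_eq]
    linarith
  have hs3 : 0 < s / 3 := by positivity
  have hmem := medComp_mem_Icc_s8 (abs_pos.1 (hs3.trans hj'))
  rw [← hM]
  rcases lt_abs.1 hj' with h | h
  · have hb : s / 3 < quantile ν (1/2 + q) := h.trans_le hmem.2
    have h1 := measure_Iic_le_of_lt_quantile hb (hs3.trans hb).ne'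
    have h2 := hfar (Ioi (s / 3)) measurableSet_Ioi fun t ht => (le_of_lt ht).trans (le_abs_self t)
    have h3 := measureReal_add_measureReal_compl (μ := ν) (measurableSet_Iic (a := s / 3))
    rw [compl_Iic] at h3
    linarith
  · have ha : quantile ν (1/2 - q) < -(s / 3) := hmem.1.trans_lt (by linarith)
    have h1 := lt_measure_Iic_of_quantile_lt ha (by linarith)
    have h2 := hfar (Iic (-(s / 3))) measurableSet_Iic fun t ht =>
      (le_neg.1 ht).trans (neg_le_abs t)
    linarith

end
end
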